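/- arXiv:1807.08853 — 5 statements merged into one kernel-verified Lean document; each statement's English description precedes it below -/
import Mathlib

section
/- Let S = {(1,0),(−1,0),(1,1),(−1,1),(1,−1),(−1,−1)} (Model 4: the four diagonal steps together with the horizontal steps). Then G_S(t;a,1) ∈ ℚ[a][[t]] and G_S(t;1,b) ∈ ℚ[b][[t]] are D-finite, and there exist D-finite power series F, H ∈ ℚ[a,b][[t]] with H ≠ 0 such that H·G_S(t;a,b) = F. -/
open PowerSeries

/-- A quarter-plane loop of length `n` with steps in `S`: a sequence of points of
`ℤ≥0 × ℤ≥0` (encoded as `ℕ × ℕ`) starting and ending at the origin, with successive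
differences in `S`. -/
def IsQPLoop (S : Set (ℤ × ℤ)) (n : ℕ) (w : Fin (n + 1) → ℕ × ℕ) : Prop :=
  w 0 = (0, 0) ∧ w (Fin.last n) = (0, 0) ∧
    ∀ i : Fin n, (((w i.succ).1 : ℤ) - ((w i.castSucc).1 : ℤ),
      ((w i.succ).2 : ℤ) - ((w i.castSucc).2 : ℤ)) ∈ S

/-- The number of visits of `w` to the horizontal boundary: indices `1 ≤ i ≤ n`
with the second coordinate of `w i` equal to `0`. -/
def hvisits {n : ℕ} (w : Fin (n + 1) → ℕ × ℕ) : ℕ :=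
  (Finset.univ.filter fun i : Fin (n + 1) => 0 < (i : ℕ) ∧ (w i).2 = 0).card

/-- The number of visits of `w` to the vertical boundary: indices `1 ≤ i ≤ n`
with the first coordinate of `w i` equal to `0`. -/
def vvisits {n : ℕ} (w : Fin (n + 1) → ℕ × ℕ) : ℕ :=
  (Finset.univ.filter fun i : Fin (n + 1) => 0 < (i : ℕ) ∧ (w i).1 = 0).card

/-- The interacting generating function `G_S(t;a,b) = Σ_n t^n Σ_w a^(h(w)) b^(v(w))`,
the inner sum over all quarter-plane loops of length `n` with steps in `S`. -/
noncomputable def loopGF (S : Set (ℤ × ℤ)) {R : Type*} [CommRing R] (a b : R) :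
    PowerSeries R :=
  PowerSeries.mk fun n =>
    ∑ᶠ w : {w : Fin (n + 1) → ℕ × ℕ // IsQPLoop S n w}, a ^ hvisits w.1 * b ^ vvisits w.1

/-- A power series `F ∈ R[[t]]` is D-finite if there are polynomials `p₀, …, p_m`,
not all zero, with `Σ pᵢ · F⁽ⁱ⁾ = 0`, where `F⁽ⁱ⁾` is the `i`-th formal derivative. -/
def IsDFinite {R : Type*} [CommRing R] (F : PowerSeries R) : Prop :=
  ∃ (m : ℕ) (p : Fin (m + 1) → Polynomial R), (∃ i, p i ≠ 0) ∧
    ∑ i : Fin (m + 1), (p i : PowerSeries R) * (PowerSeries.derivativeFun)^[(i : ℕ)] F = 0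

section Saturation

variable {P V : Type*} [CommRing P] [AddCommGroup V] [Module P V]

theorem exists_leading_relation {x : ℕ → V} (h : ¬ LinearIndependent P x) :
    ∃ (m : ℕ) (c : ℕ → P), c m ≠ 0 ∧ ∑ i ∈ Finset.range (m + 1), c i • x i = 0 := by
  obtain ⟨c, hc, hne⟩ : ∃ c : ℕ →₀ P, Finsupp.linearCombination P x c = 0 ∧ c ≠ 0 := by
    rw [linearIndependent_iff] at h
    push Not at h
    exact h
  have hs : c.support.Nonempty := Finsupp.support_nonempty_iff.2 hne
  refine ⟨c.support.max' hs, c, Finsupp.mem_support_iff.1 (c.support.max'_mem hs), ?_⟩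
  rw [← hc, Finsupp.linearCombination_apply, Finsupp.sum]
  refine (Finset.sum_subset (fun i hi => ?_) fun i _ hi => ?_).symm
  · exact Finset.mem_range_succ_iff.2 (c.support.le_max' i hi)
  · simp [Finsupp.notMem_support_iff.1 hi]

theorem not_linearIndependent_of_sum_range {x : ℕ → V} {c : ℕ → P} {N i : ℕ} (hi : i < N)
    (hc : c i ≠ 0) (h : ∑ k ∈ Finset.range N, c k • x k = 0) : ¬ LinearIndependent P x :=
  not_linearIndependent_iff.2 ⟨Finset.range N, c, h, i, Finset.mem_range.2 hi, hc⟩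

/-- The elements having a nonzero multiple in `W`. -/
def saturation [IsDomain P] (W : Submodule P V) : Submodule P V where
  carrier := {v | ∃ c : P, c ≠ 0 ∧ c • v ∈ W}
  zero_mem' := ⟨1, one_ne_zero, by simp⟩
  add_mem' := by
    rintro v w ⟨c, hc, hv⟩ ⟨d, hd, hw⟩
    refine ⟨c * d, mul_ne_zero hc hd, ?_⟩
    rw [smul_add, mul_comm c d, mul_smul, mul_comm d c, mul_smul]
    exact W.add_mem (W.smul_mem d hv) (W.smul_mem c hw)
  smul_mem' := by
    rintro r v ⟨c, hc, hv⟩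
    exact ⟨c, hc, by rw [smul_comm]; exact W.smul_mem r hv⟩

theorem le_saturation [IsDomain P] (W : Submodule P V) : W ≤ saturation W :=
  fun v hv => ⟨1, one_ne_zero, by simpa using hv⟩

theorem mem_saturation_of_smul_mem [IsDomain P] {W : Submodule P V} {c : P} {v : V} (hc : c ≠ 0)
    (h : c • v ∈ saturation W) : v ∈ saturation W := by
  obtain ⟨d, hd, h⟩ := h
  exact ⟨d * c, mul_ne_zero hd hc, by rwa [mul_smul]⟩

theorem not_linearIndependent_of_mem_saturation [IsDomain P] {W : Submodule P V} (hW : W.FG)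
    {x : ℕ → V} (hx : ∀ k, x k ∈ saturation W) : ¬ LinearIndependent P x := by
  intro hli
  choose c hc hcx using hx
  have hli' : LinearIndependent P fun k => (⟨c k • x k, hcx k⟩ : W) := by
    refine LinearIndependent.of_comp W.subtype ?_
    rw [linearIndependent_iff'] at hli ⊢
    intro s g hg i hi
    have := hli s (fun k => g k * c k) (by simpa [mul_smul] using hg) i hi
    exact (mul_eq_zero.1 this).resolve_right (hc i)
  have : Module.Finite P W := Module.Finite.iff_fg.2 hW
  have := hli'.finite
  exact not_finite ℕ

end Saturation

theorem polynomial_smul_eq_mul {R : Type*} [CommRing R] (p : Polynomial R) (f : PowerSeries R) :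
    p • f = (p : PowerSeries R) * f := by
  rw [Algebra.smul_def, PowerSeries.algebraMap_apply', Algebra.algebraMap_self, PowerSeries.map_id,
    id]

section Sequences

variable {R : Type*} [CommRing R]

/-- Sequences form a module over polynomials, a polynomial acting by its values at `0, 1, 2, …`. -/
noncomputable abbrev sequenceModule (R : Type*) [CommRing R] : Module (Polynomial R) (ℕ → R) :=
  Module.compHom (ℕ → R) (RingHom.pi fun n : ℕ => Polynomial.evalRingHom (n : R))

attribute [local instance] sequenceModule

theorem sequence_smul_apply (p : Polynomial R) (u : ℕ → R) (n : ℕ) :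
    (p • u) n = p.eval (n : R) * u n := rfl

theorem sum_sequence_smul_apply (s : Finset ℕ) (c : ℕ → Polynomial R)
    (x : ℕ → ℕ → R) (n : ℕ) :
    (∑ i ∈ s, c i • x i) n = ∑ i ∈ s, (c i).eval (n : R) * x i n := by
  rw [Finset.sum_apply]; rfl

/-- The sequence `u` advanced by `i`. -/
def shift (u : ℕ → R) (i : ℕ) : ℕ → R := fun n => u (n + i)

/-- A sequence is P-recursive if its shifts are linearly dependent over the polynomials in `n`. -/
def IsPRecursive (u : ℕ → R) : Prop := ¬ LinearIndependent (Polynomial R) (shift u)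

theorem shift_mem_of_relation [IsDomain R] {u : ℕ → R} {m : ℕ} {c : ℕ → Polynomial R}
    (hm : c m ≠ 0) (hc : ∑ i ∈ Finset.range (m + 1), c i • shift u i = 0) (v : ℕ → R)
    {W : Submodule (Polynomial R) (ℕ → R)} (hW : ∀ i < m, shift u i * v ∈ saturation W) (k : ℕ) :
    shift u k * v ∈ saturation W := by
  induction k using Nat.strong_induction_on with
  | _ k ih =>
    rcases lt_or_ge k m with hk | hk
    · exact hW k hk
    obtain ⟨k, rfl⟩ := Nat.exists_eq_add_of_le hk
    let T : Polynomial R → Polynomial R := fun p => p.comp (Polynomial.X + Polynomial.C (k : R))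
    have hT : T (c m) ≠ 0 := by
      rwa [Ne, Polynomial.comp_X_add_C_eq_zero_iff]
    refine mem_saturation_of_smul_mem hT ?_
    have hrel : T (c m) • (shift u (m + k) * v) =
        -∑ i ∈ Finset.range m, T (c i) • (shift u (i + k) * v) := by
      rw [eq_neg_iff_add_eq_zero, add_comm, ← Finset.sum_range_succ
        (fun i => T (c i) • (shift u (i + k) * v))]
      funext n
      rw [sum_sequence_smul_apply]
      have := congrFun hc (n + k)
      rw [sum_sequence_smul_apply] at this
      calc _ = (∑ i ∈ Finset.range (m + 1), (c i).eval ((n + k : ℕ) : R) * shift u i (n + k)) *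
            v n := by
            rw [Finset.sum_mul]
            refine Finset.sum_congr rfl fun i _ => ?_
            simp [T, shift, add_assoc, add_comm k i, mul_assoc]
        _ = _ := by rw [this]; simp
    rw [hrel]
    refine neg_mem (sum_mem fun i hi => Submodule.smul_mem _ _ (ih _ ?_))
    have := Finset.mem_range.1 hi
    omega

theorem IsPRecursive.mul [IsDomain R] {u v : ℕ → R} (hu : IsPRecursive u) (hv : IsPRecursive v) :
    IsPRecursive (u * v) := by
  obtain ⟨m, c, hm, hc⟩ := exists_leading_relation hu
  obtain ⟨l, d, hl, hd⟩ := exists_leading_relation hv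
  let s : Set (ℕ → R) := (fun p : ℕ × ℕ => shift u p.1 * shift v p.2) '' Set.Iio m ×ˢ Set.Iio l
  have hs : s.Finite := ((Set.finite_Iio m).prod (Set.finite_Iio l)).image _
  have hmem : ∀ i j, shift u i * shift v j ∈ saturation (Submodule.span (Polynomial R) s) := by
    intro i j
    refine shift_mem_of_relation hm hc _ (fun i hi => ?_) i
    rw [mul_comm]
    refine shift_mem_of_relation hl hd _ (fun j hj => ?_) j
    refine le_saturation _ (Submodule.subset_span ?_)
    rw [mul_comm]
    exact ⟨(i, j), ⟨hi, hj⟩, rfl⟩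
  exact not_linearIndependent_of_mem_saturation (Submodule.fg_span hs) fun k => hmem k k

theorem coeff_add_polynomial_mul (A : Polynomial R) {N : ℕ} (hA : A.natDegree ≤ N)
    (f : PowerSeries R) (n : ℕ) :
    coeff (n + N) ((A : PowerSeries R) * f) =
      ∑ i ∈ Finset.range (N + 1), A.coeff (N - i) * coeff (n + i) f := by
  rw [mul_comm, PowerSeries.coeff_mul, Finset.Nat.sum_antidiagonal_eq_sum_range_succ_mk,
    Nat.succ_eq_add_one, add_assoc, Finset.sum_range_add, Finset.sum_eq_zero, zero_add]
  · refine Finset.sum_congr rfl fun i hi => ?_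
    rw [mul_comm, Polynomial.coeff_coe]
    congr 2
    omega
  · intro i hi
    have := Finset.mem_range.1 hi
    rw [Polynomial.coeff_coe, Polynomial.coeff_eq_zero_of_natDegree_lt (by omega), mul_zero]

theorem coeff_X_mul_derivative (f : PowerSeries R) (n : ℕ) :
    coeff n (X * d⁄dX R f) = n * coeff n f := by
  cases n with
  | zero => simp
  | succ n =>
    rw [coeff_succ_X_mul, coeff_derivative, mul_comm]
    push_cast
    rfl

theorem isPRecursive_coeff_of_differential_equation {A B C : Polynomial R} (hA : A ≠ 0)
    {f : PowerSeries R}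
    (h : (A : PowerSeries R) * (X * d⁄dX R f) + (B : PowerSeries R) * f = (C : PowerSeries R)) :
    IsPRecursive fun n => coeff n f := by
  set N := A.natDegree + B.natDegree + C.natDegree + 1 with hN
  refine not_linearIndependent_of_sum_range (N := N + 1) (i := N - A.natDegree)
    (c := fun i => Polynomial.C (A.coeff (N - i)) * (Polynomial.X + Polynomial.C (i : R)) +
      Polynomial.C (B.coeff (N - i))) (by omega) (fun h0 => hA ?_) ?_
  · have := congrArg (Polynomial.coeff · 1) h0
    rw [← Polynomial.leadingCoeff_eq_zero, Polynomial.leadingCoeff]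
    simpa [Polynomial.coeff_C, Nat.sub_sub_self (show A.natDegree ≤ N by omega)] using this
  · funext n
    have hn := congrArg (coeff (n + N)) h
    rw [map_add, coeff_add_polynomial_mul A (by omega), coeff_add_polynomial_mul B (by omega),
      Polynomial.coeff_coe, Polynomial.coeff_eq_zero_of_natDegree_lt (by omega),
      ← Finset.sum_add_distrib] at hn
    rw [sum_sequence_smul_apply, Pi.zero_apply, ← hn]
    refine Finset.sum_congr rfl fun i _ => ?_
    rw [coeff_X_mul_derivative]
    push_cast
    simp [shift]
    ring

/-- The `k`-th iterate of `X * d/dX` at the generating function of `u`. -/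
noncomputable def eulerIterate (u : ℕ → R) (k : ℕ) : PowerSeries R :=
  PowerSeries.mk fun n => (n : R) ^ k * u n

theorem not_linearIndependent_eulerIterate [IsDomain R] {u : ℕ → R} (hu : IsPRecursive u) :
    ¬ LinearIndependent (Polynomial R) (eulerIterate u) := by
  obtain ⟨m, c, hm, hc⟩ := exists_leading_relation hu
  let w : Polynomial R := ∏ j ∈ Finset.range m, (Polynomial.X + Polynomial.C (j + 1 : R))
  have hw : w ≠ 0 := Finset.prod_ne_zero_iff.2 fun j _ => Polynomial.X_add_C_ne_zero _
  let q : ℕ → Polynomial R := fun i => (w * c i).comp (Polynomial.X + Polynomial.C (-i : R))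
  have hq : q m ≠ 0 := by
    rw [Ne, Polynomial.comp_X_add_C_eq_zero_iff]
    exact mul_ne_zero hw hm
  let K := (∑ i ∈ Finset.range (m + 1), (q i).natDegree) + 1
  have hK : ∀ i ∈ Finset.range (m + 1), (q i).natDegree < K := fun i hi =>
    Nat.lt_succ_of_le (Finset.single_le_sum (f := fun i => (q i).natDegree)
      (fun _ _ => Nat.zero_le _) hi)
  refine not_linearIndependent_of_sum_range (N := K) (i := (q m).natDegree)
    (c := fun k => ∑ i ∈ Finset.range (m + 1), Polynomial.monomial (m - i) ((q i).coeff k))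
    (hK m (by simp)) (fun h0 => hq ?_) ?_
  · have := congrArg (Polynomial.coeff · 0) h0
    rw [← Polynomial.leadingCoeff_eq_zero, Polynomial.leadingCoeff]
    rw [Finset.sum_range_succ] at this
    simp only [Polynomial.coeff_add, Polynomial.finsetSum_coeff, Polynomial.coeff_monomial,
      Nat.sub_self, if_true, Polynomial.coeff_zero] at this
    rwa [Finset.sum_eq_zero, zero_add] at this
    intro i hi
    have := Finset.mem_range.1 hi
    rw [if_neg (by omega)]
  · ext N
    have hterm : ∀ i ∈ Finset.range (m + 1),
        ∑ k ∈ Finset.range K,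
          coeff N (((Polynomial.monomial (m - i) ((q i).coeff k) : Polynomial R) : PowerSeries R) *
            eulerIterate u k) =
        if m - i ≤ N then
          (q i).eval ((N - (m - i) : ℕ) : R) * u (N - (m - i)) else 0 := by
      intro i hi
      split_ifs with h
      · rw [Polynomial.eval_eq_sum_range' (hK i hi), Finset.sum_mul]
        refine Finset.sum_congr rfl fun k _ => ?_
        rw [← Polynomial.C_mul_X_pow_eq_monomial, Polynomial.coe_mul, Polynomial.coe_C,
          Polynomial.coe_pow, Polynomial.coe_X, mul_assoc, coeff_C_mul, coeff_X_pow_mul', if_pos h,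
          eulerIterate, coeff_mk, mul_assoc]
      · refine Finset.sum_eq_zero fun k _ => ?_
        rw [← Polynomial.C_mul_X_pow_eq_monomial, Polynomial.coe_mul, Polynomial.coe_C,
          Polynomial.coe_pow, Polynomial.coe_X, mul_assoc, coeff_C_mul, coeff_X_pow_mul', if_neg h,
          mul_zero]
    simp only [Finset.sum_smul, polynomial_smul_eq_mul, map_sum, map_zero]
    rw [Finset.sum_comm, Finset.sum_congr rfl hterm]
    rcases le_or_gt m N with h | h
    · obtain ⟨n, rfl⟩ := Nat.exists_eq_add_of_le h
      have hn := congrFun hc n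
      rw [sum_sequence_smul_apply, Pi.zero_apply] at hn
      rw [← mul_zero (w.eval (n : R)), ← hn, Finset.mul_sum]
      refine Finset.sum_congr rfl fun i hi => ?_
      have := Finset.mem_range.1 hi
      rw [if_pos (by omega), show m + n - (m - i) = n + i by omega]
      simp [q, shift, mul_assoc]
    · refine Finset.sum_eq_zero fun i hi => ?_
      split_ifs with hi'
      · have := Finset.mem_range.1 hi
        have hz : ((N - (m - i) : ℕ) : R) - i + ((m - N - 1 : ℕ) + 1) = 0 := by
          have : ((N - (m - i) + (m - N - 1 + 1) : ℕ) : R) = (i : ℕ) := by congr 1; omega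
          push_cast at this
          rw [sub_add_eq_add_sub, this, sub_self]
        have hw0 : w.eval (((N - (m - i) : ℕ) : R) - i) = 0 := by
          rw [Polynomial.eval_prod]
          exact Finset.prod_eq_zero (Finset.mem_range.2 (show m - N - 1 < m by omega))
            (by simpa using hz)
        simp [q, ← sub_eq_add_neg, hw0]
      · rfl

end Sequences

section EulerOperator

variable {R : Type*} [CommRing R]

theorem eulerIterate_succ (u : ℕ → R) (k : ℕ) :
    eulerIterate u (k + 1) = X * d⁄dX R (eulerIterate u k) := by
  ext n
  rw [coeff_X_mul_derivative, eulerIterate, eulerIterate, coeff_mk, coeff_mk, pow_succ']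
  ring

theorem eulerIterate_sub_mem (u : ℕ → R) (k : ℕ) :
    eulerIterate u k - (Polynomial.X ^ k : Polynomial R) • (d⁄dX R)^[k] (mk u) ∈
      Submodule.span (Polynomial R) ((fun i => (d⁄dX R)^[i] (mk u)) '' Set.Iio k) := by
  have hmono : ∀ {i k : ℕ}, i < k → (d⁄dX R)^[i] (mk u) ∈
      Submodule.span (Polynomial R) ((fun i => (d⁄dX R)^[i] (mk u)) '' Set.Iio k) :=
    fun h => Submodule.subset_span ⟨_, h, rfl⟩
  have hd : ∀ (k : ℕ) (g : PowerSeries R),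
      g ∈ Submodule.span (Polynomial R) ((fun i => (d⁄dX R)^[i] (mk u)) '' Set.Iio k) →
      d⁄dX R g ∈ Submodule.span (Polynomial R)
        ((fun i => (d⁄dX R)^[i] (mk u)) '' Set.Iio (k + 1)) := by
    intro k g hg
    induction hg using Submodule.span_induction with
    | mem x hx =>
      obtain ⟨i, hi, rfl⟩ := hx
      rw [← Function.iterate_succ_apply' (d⁄dX R)]
      exact hmono (Nat.succ_lt_succ hi)
    | zero => simp
    | add x y _ _ hx hy => rw [map_add]; exact add_mem hx hy
    | smul p x hxm hx =>
      rw [polynomial_smul_eq_mul, Derivation.leibniz, derivative_coe, smul_eq_mul, smul_eq_mul,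
        ← polynomial_smul_eq_mul, mul_comm, ← polynomial_smul_eq_mul]
      refine add_mem (Submodule.smul_mem _ _ hx) (Submodule.smul_mem _ _ ?_)
      exact Submodule.span_mono (Set.image_mono (Set.Iio_subset_Iio (Nat.le_succ k))) hxm
  induction k with
  | zero =>
    have : eulerIterate u 0 = mk u := by ext n; simp [eulerIterate]
    simp [this]
  | succ k ih =>
    have key : eulerIterate u (k + 1) - (Polynomial.X ^ (k + 1) : Polynomial R) •
          (d⁄dX R)^[k + 1] (mk u) =
        (Polynomial.X : Polynomial R) • d⁄dX R (eulerIterate u k -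
          (Polynomial.X ^ k : Polynomial R) • (d⁄dX R)^[k] (mk u)) +
        (Polynomial.X * Polynomial.derivative (Polynomial.X ^ k) : Polynomial R) •
          (d⁄dX R)^[k] (mk u) := by
      simp only [polynomial_smul_eq_mul, eulerIterate_succ, map_sub, Derivation.leibniz,
        Function.iterate_succ_apply', Polynomial.coe_mul, ← derivative_coe, smul_eq_mul, pow_succ,
        Polynomial.coe_X]
      ring
    rw [key]
    exact add_mem (Submodule.smul_mem _ _ (hd k _ ih)) (Submodule.smul_mem _ _ (hmono k.lt_succ_self))

theorem isDFinite_of_not_linearIndependent {F : PowerSeries R}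
    (h : ¬ LinearIndependent (Polynomial R) fun i => (d⁄dX R)^[i] F) : IsDFinite F := by
  obtain ⟨m, c, hm, hc⟩ := exists_leading_relation h
  refine ⟨m, fun i => c i, ⟨Fin.last m, hm⟩, ?_⟩
  rw [Finset.sum_range] at hc
  simp only [polynomial_smul_eq_mul] at hc
  exact hc

theorem IsPRecursive.isDFinite [IsDomain R] {u : ℕ → R} (hu : IsPRecursive u) :
    IsDFinite (mk u) := by
  have hdep := not_linearIndependent_eulerIterate hu
  obtain ⟨m, c, hm, hc⟩ := exists_leading_relation hdep
  refine isDFinite_of_not_linearIndependent fun hli => ?_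
  have hmem : (c m * Polynomial.X ^ m) • (d⁄dX R)^[m] (mk u) ∈
      Submodule.span (Polynomial R) ((fun i => (d⁄dX R)^[i] (mk u)) '' (Set.univ \ {m})) := by
    have hlow : ∀ k ≤ m,
        eulerIterate u k - (Polynomial.X ^ k : Polynomial R) • (d⁄dX R)^[k] (mk u) ∈
        Submodule.span (Polynomial R) ((fun i => (d⁄dX R)^[i] (mk u)) '' (Set.univ \ {m})) :=
      fun k hk => Submodule.span_mono (Set.image_mono (t := Set.univ \ {m}) fun i hi =>
        ⟨trivial, (lt_of_lt_of_le (Set.mem_Iio.1 hi) hk).ne⟩) (eulerIterate_sub_mem u k)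
    have hexp : (c m * Polynomial.X ^ m) • (d⁄dX R)^[m] (mk u) =
        -(∑ k ∈ Finset.range m, c k • eulerIterate u k) - c m • (eulerIterate u m -
          (Polynomial.X ^ m : Polynomial R) • (d⁄dX R)^[m] (mk u)) := by
      rw [Finset.sum_range_succ, ← eq_neg_iff_add_eq_zero] at hc
      rw [hc, smul_sub, smul_smul]
      abel
    rw [hexp]
    refine sub_mem (neg_mem (sum_mem fun k hk => Submodule.smul_mem _ _ ?_))
      (Submodule.smul_mem _ _ (hlow m le_rfl))
    have hk' := Finset.mem_range.1 hk
    rw [← sub_add_cancel (eulerIterate u k) ((Polynomial.X ^ k : Polynomial R) •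
      (d⁄dX R)^[k] (mk u))]
    exact add_mem (hlow k hk'.le) (Submodule.smul_mem _ _
      (Submodule.subset_span ⟨k, ⟨trivial, hk'.ne⟩, rfl⟩))
  exact mul_ne_zero hm (pow_ne_zero _ Polynomial.X_ne_zero)
    (hli.eq_zero_of_smul_mem_span m _ hmem)

end EulerOperator

section WeightedPaths

variable {R : Type*} [CommRing R]

/-- The total weight of the `n`-step paths on `ℕ` from `0` to `k`, where `N l` is the set of
points from which `l` can be reached in one step and every visit to `0` has weight `c`. -/
def pathWeight (N : ℕ → Finset ℕ) (c : R) : ℕ → ℕ → R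
  | 0, k => if k = 0 then 1 else 0
  | n + 1, k => (if k = 0 then c else 1) * ∑ l ∈ N k, pathWeight N c n l

/-- The coefficients of the series `r` with `r = X * (1 + e * r + r ^ 2)`. -/
def kernelCoeff (e : R) : ℕ → R
  | 0 => 0
  | n + 1 => (if n = 0 then 1 else 0) + e * kernelCoeff e n +
      ∑ i : Fin (n + 1), kernelCoeff e i * kernelCoeff e (n - i)

theorem exists_kernel_root (e : R) :
    ∃ r : PowerSeries R, r = X * (1 + C e * r + r ^ 2) := by
  refine ⟨PowerSeries.mk (kernelCoeff e), ?_⟩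
  ext n
  cases n with
  | zero => simp [kernelCoeff]
  | succ n =>
    rw [coeff_succ_X_mul, coeff_mk, kernelCoeff, map_add, map_add, coeff_C_mul, sq, coeff_mul,
      Finset.Nat.sum_antidiagonal_eq_sum_range_succ_mk, coeff_mk, coeff_one,
      Fin.sum_univ_eq_sum_range (fun i => kernelCoeff e i * kernelCoeff e (n - i))]
    simp

theorem coeff_kernel_root_pow_mul {N : ℕ → Finset ℕ} {c e : R}
    (h0 : ∀ f : ℕ → R, ∑ l ∈ N 0, f l = e * f 0 + f 1)
    (hN : ∀ (f : ℕ → R) (k : ℕ), ∑ l ∈ N (k + 1), f l = f k + e * f (k + 1) + f (k + 2))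
    {r D : PowerSeries R} (hr : r = X * (1 + C e * r + r ^ 2))
    (hD : D = 1 + C c * (X * ((C e + r) * D))) (n k : ℕ) :
    coeff n (r ^ k * D) = pathWeight N c n k := by
  have hstep : ∀ k, r ^ (k + 1) * D =
      X * (r ^ k * D + C e * (r ^ (k + 1) * D) + r ^ (k + 2) * D) := by
    intro k
    calc r ^ (k + 1) * D = r ^ k * r * D := by ring
      _ = r ^ k * (X * (1 + C e * r + r ^ 2)) * D := by rw [← hr]
      _ = _ := by ring
  induction n generalizing k with
  | zero =>
    cases k with
    | zero => rw [pow_zero, one_mul, hD]; simp [pathWeight]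
    | succ k => rw [hstep]; simp [pathWeight]
  | succ n ih =>
    cases k with
    | zero =>
      have : r ^ 0 * D = 1 + C c * (X * (C e * (r ^ 0 * D) + r ^ 1 * D)) := by
        rw [pow_zero, one_mul, pow_one, ← add_mul]; exact hD
      rw [this, map_add, coeff_C_mul, coeff_succ_X_mul, map_add, coeff_C_mul, ih, ih, pathWeight,
        if_pos rfl, h0, coeff_one, if_neg n.succ_ne_zero, zero_add]
    | succ k =>
      rw [hstep, coeff_succ_X_mul, map_add, map_add, coeff_C_mul, ih, ih, ih, pathWeight,
        if_neg k.succ_ne_zero, hN, one_mul]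

theorem differential_equation_of_kernel {c e : R} {r D : PowerSeries R}
    (hr : r = X * (1 + C e * r + r ^ 2)) (hD : D = 1 + C c * (X * ((C e + r) * D)))
    {Δ Q U : Polynomial R}
    (hΔ : Δ = (1 - Polynomial.C e * Polynomial.X) ^ 2 - 4 * Polynomial.X ^ 2)
    (hU : U = 2 - Polynomial.C c - Polynomial.C c * Polynomial.C e * Polynomial.X)
    (hQ : Q = U ^ 2 - Polynomial.C c ^ 2 * Δ) :
    ((2 * Δ * Q : Polynomial R) : PowerSeries R) * (X * d⁄dX R D) +
      ((Polynomial.X * (2 * Δ * Polynomial.derivative Q - Polynomial.derivative Δ * Q) :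
        Polynomial R) : PowerSeries R) * D =
      ((Polynomial.X * (4 * Δ * Polynomial.derivative U - 2 * Polynomial.derivative Δ * U) :
        Polynomial R) : PowerSeries R) := by
  have hcoe2 : ((2 : Polynomial R) : PowerSeries R) = 2 :=
    map_ofNat Polynomial.coeToPowerSeries.ringHom 2
  have hcoe4 : ((4 : Polynomial R) : PowerSeries R) = 4 :=
    map_ofNat Polynomial.coeToPowerSeries.ringHom 4
  set s : PowerSeries R := 1 - C e * X - 2 * X * r with hs
  have hΔ' : (Δ : PowerSeries R) = s ^ 2 := by
    rw [hΔ, hs]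
    simp only [Polynomial.coe_sub, Polynomial.coe_mul, Polynomial.coe_pow, Polynomial.coe_C,
      Polynomial.coe_X, Polynomial.coe_one, hcoe4]
    linear_combination (4 * X : PowerSeries R) * hr
  have hU' : (U : PowerSeries R) = 2 - C c - C c * C e * X := by
    rw [hU]
    simp only [Polynomial.coe_sub, Polynomial.coe_mul, Polynomial.coe_C, Polynomial.coe_X, hcoe2]
  have hQ' : (Q : PowerSeries R) = U ^ 2 - C c ^ 2 * Δ := by
    rw [hQ]
    simp only [Polynomial.coe_sub, Polynomial.coe_mul, Polynomial.coe_pow, Polynomial.coe_C]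
  have hDs : D * (U + C c * s) = 2 := by
    rw [hU', hs]
    linear_combination (2 : PowerSeries R) * hD
  have hf : (Q : PowerSeries R) * D - 2 * U = -(2 * C c * s) := by
    rw [hQ', hΔ']
    linear_combination (U - C c * s) * hDs
  have hd := congrArg (d⁄dX R) hf
  have hdΔ := congrArg (d⁄dX R) hΔ'
  have hd2 : d⁄dX R (2 : PowerSeries R) = 0 := by
    simpa using (d⁄dX R).map_natCast 2
  simp only [map_sub, map_neg, Derivation.leibniz, Derivation.leibniz_pow, smul_eq_mul,
    derivative_coe, derivative_C, hd2, mul_zero, add_zero] at hd hdΔ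
  simp only [Polynomial.coe_sub, Polynomial.coe_mul, Polynomial.coe_X, hcoe2, hcoe4]
  linear_combination (2 * X * (Δ : PowerSeries R)) * hd -
    (X * (Polynomial.derivative Δ : PowerSeries R)) * hf -
    (4 * C c * X * d⁄dX R s) * hΔ' + (2 * C c * s * X) * hdΔ

theorem isPRecursive_pathWeight [IsDomain R] [CharZero R] {N : ℕ → Finset ℕ} {e : R}
    (h0 : ∀ f : ℕ → R, ∑ l ∈ N 0, f l = e * f 0 + f 1)
    (hN : ∀ (f : ℕ → R) (k : ℕ), ∑ l ∈ N (k + 1), f l = f k + e * f (k + 1) + f (k + 2))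
    (c : R) : IsPRecursive fun n => pathWeight N c n 0 := by
  obtain ⟨r, hr⟩ := exists_kernel_root e
  have hinv : (1 - C c * (X * (C e + r))) *
      invOfUnit (1 - C c * (X * (C e + r))) 1 = 1 := mul_invOfUnit _ _ (by simp)
  set D := invOfUnit (1 - C c * (X * (C e + r))) 1
  have hD : D = 1 + C c * (X * ((C e + r) * D)) := by linear_combination hinv
  have hcoeff : (fun n => pathWeight N c n 0) = fun n => coeff n D := by
    funext n
    rw [← coeff_kernel_root_pow_mul h0 hN hr hD, pow_zero, one_mul]
  rw [hcoeff]
  refine isPRecursive_coeff_of_differential_equation ?_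
    (differential_equation_of_kernel hr hD rfl rfl rfl)
  refine mul_ne_zero (mul_ne_zero two_ne_zero fun h => ?_) fun h => ?_
  · simpa using congrArg (Polynomial.eval 0) h
  · have hQ : (2 - Polynomial.C c - Polynomial.C c * Polynomial.C e * Polynomial.X) ^ 2 -
        Polynomial.C c ^ 2 * ((1 - Polynomial.C e * Polynomial.X) ^ 2 - 4 * Polynomial.X ^ 2) =
        Polynomial.C (4 * c ^ 2) * Polynomial.X ^ 2 +
          Polynomial.C (4 * c * e * (c - 1)) * Polynomial.X + Polynomial.C (4 * (1 - c)) := by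
      simp only [map_mul, map_sub, map_pow, map_one, map_ofNat]
      ring
    rw [hQ] at h
    have hc2 : c = 0 := by
      simpa [-map_mul, -map_sub, Polynomial.coeff_X, Polynomial.coeff_C] using
        congrArg (Polynomial.coeff · 2) h
    simpa [hc2] using congrArg (Polynomial.eval 0) h

end WeightedPaths

section Loops

/-- The walks of length `n` in the quarter plane from the origin to `p`, where `N q` is the set
of points from which `q` can be reached in one step. -/
def walks (N : ℕ × ℕ → Finset (ℕ × ℕ)) : (n : ℕ) → ℕ × ℕ → Finset (Fin (n + 1) → ℕ × ℕ)
  | 0, p => if p = (0, 0) then {fun _ => (0, 0)} else ∅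
  | n + 1, p => (N p).biUnion fun q =>
      (walks N n q).image fun w => (Fin.snoc w p : Fin (n + 2) → ℕ × ℕ)

theorem mem_walks {N : ℕ × ℕ → Finset (ℕ × ℕ)} {n : ℕ} {p : ℕ × ℕ} {w : Fin (n + 1) → ℕ × ℕ} :
    w ∈ walks N n p ↔
      w 0 = (0, 0) ∧ w (Fin.last n) = p ∧ ∀ i : Fin n, w i.castSucc ∈ N (w i.succ) := by
  induction n generalizing p with
  | zero =>
    have hw : w = (fun _ => (0, 0)) ↔ w 0 = (0, 0) := by
      rw [funext_iff, Fin.forall_fin_one]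
    by_cases hp : p = (0, 0)
    · simp [walks, hp, hw]
    · simp only [walks, hp, if_false, Finset.notMem_empty, false_iff, not_and]
      intro h h'
      exact absurd (h'.symm.trans h) hp
  | succ n ih =>
    simp only [walks, Finset.mem_biUnion, Finset.mem_image, ih]
    constructor
    · rintro ⟨q, hq, v, ⟨hv0, hvl, hv⟩, rfl⟩
      refine ⟨?_, Fin.snoc_last _ _, fun i => ?_⟩
      · rw [← Fin.castSucc_zero, Fin.snoc_castSucc, hv0]
      · induction i using Fin.lastCases with
        | last => rwa [Fin.succ_last, Fin.snoc_last, Fin.snoc_castSucc, hvl]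
        | cast i => rw [Fin.snoc_castSucc, ← Fin.castSucc_succ, Fin.snoc_castSucc]; exact hv i
    · rintro ⟨h0, rfl, h⟩
      refine ⟨w (Fin.last n).castSucc, h (Fin.last n), Fin.init w, ⟨h0, rfl, fun i => ?_⟩,
        Fin.snoc_init_self w⟩
      exact h i.castSucc

theorem card_filter_pos_snoc {n : ℕ} (w : Fin (n + 1) → ℕ × ℕ) (p : ℕ × ℕ) (f : ℕ × ℕ → ℕ) :
    (Finset.univ.filter fun i : Fin (n + 2) =>
      0 < (i : ℕ) ∧ f ((Fin.snoc w p : Fin (n + 2) → ℕ × ℕ) i) = 0).card =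
    (Finset.univ.filter fun i : Fin (n + 1) => 0 < (i : ℕ) ∧ f (w i) = 0).card +
      if f p = 0 then 1 else 0 := by
  rw [Finset.card_filter, Finset.card_filter, Fin.sum_univ_castSucc]
  simp

theorem sum_walks {R : Type*} [CommRing R] (N₁ N₂ : ℕ → Finset ℕ) (a b : R) (n i j : ℕ) :
    ∑ w ∈ walks (fun p => N₁ p.1 ×ˢ N₂ p.2) n (i, j), a ^ hvisits w * b ^ vvisits w =
      pathWeight N₁ b n i * pathWeight N₂ a n j := by
  induction n generalizing i j with
  | zero =>
    by_cases hi : i = 0 <;> by_cases hj : j = 0 <;>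
      simp [walks, pathWeight, hi, hj, hvisits, vvisits]
  | succ n ih =>
    rw [walks, Finset.sum_biUnion, Finset.sum_product, pathWeight, pathWeight, mul_mul_mul_comm,
      Finset.sum_mul_sum, Finset.mul_sum]
    · refine Finset.sum_congr rfl fun k _ => ?_
      rw [Finset.mul_sum]
      refine Finset.sum_congr rfl fun l _ => ?_
      rw [Finset.sum_image fun w _ v _ h => (Fin.snoc_injective2 h).1, ← ih, Finset.mul_sum]
      refine Finset.sum_congr rfl fun w _ => ?_
      rw [hvisits, vvisits, card_filter_pos_snoc w (i, j) Prod.snd,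
        card_filter_pos_snoc w (i, j) Prod.fst, ← hvisits, ← vvisits, pow_add, pow_add]
      split_ifs <;> ring
    · intro q _ q' _ hqq'
      rw [Function.onFun, Finset.disjoint_left]
      intro w hw hw'
      obtain ⟨v, hv, rfl⟩ := Finset.mem_image.1 hw
      obtain ⟨v', hv', h⟩ := Finset.mem_image.1 hw'
      obtain rfl := (Fin.snoc_injective2 h).1
      exact hqq' ((mem_walks.1 hv).2.1.symm.trans (mem_walks.1 hv').2.1)

/-- The neighbours of a point of `ℕ` for the steps `±1`. -/
def dyckNeighbors : ℕ → Finset ℕ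
  | 0 => {1}
  | k + 1 => {k, k + 2}

/-- The neighbours of a point of `ℕ` for the steps `-1, 0, 1`. -/
def motzkinNeighbors : ℕ → Finset ℕ
  | 0 => {0, 1}
  | k + 1 => {k, k + 1, k + 2}

theorem mem_dyckNeighbors {k l : ℕ} : l ∈ dyckNeighbors k ↔ l = k + 1 ∨ k = l + 1 := by
  cases k <;> simp [dyckNeighbors] <;> omega

theorem mem_motzkinNeighbors {k l : ℕ} :
    l ∈ motzkinNeighbors k ↔ l = k + 1 ∨ l = k ∨ k = l + 1 := by
  cases k <;> simp [motzkinNeighbors] <;> omega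

theorem loopGF_eq_mk_mul {R : Type*} [CommRing R] (a b : R) :
    loopGF ({((1:ℤ), (0:ℤ)), (-1, 0), (1, 1), (-1, 1), (1, -1), (-1, -1)} : Set (ℤ × ℤ)) a b =
      PowerSeries.mk ((fun n => pathWeight dyckNeighbors b n 0) *
        fun n => pathWeight motzkinNeighbors a n 0) := by
  ext n
  rw [loopGF, coeff_mk, coeff_mk, Pi.mul_apply, ← sum_walks, ← finsum_mem_finset_eq_sum]
  rw [finsum_subtype_eq_finsum_cond (f := fun w => a ^ hvisits w * b ^ vvisits w) (IsQPLoop _ n)]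
  refine finsum_congr fun w => ?_
  refine finsum_congr_Prop (propext ?_) fun _ => rfl
  rw [mem_walks, IsQPLoop]
  refine and_congr_right fun _ => and_congr_right fun _ => forall_congr' fun i => ?_
  rw [Finset.mem_product, mem_dyckNeighbors, mem_motzkinNeighbors]
  simp only [Set.mem_insert_iff, Set.mem_singleton_iff, Prod.mk.injEq]
  omega

theorem isDFinite_loopGF {R : Type*} [CommRing R] [IsDomain R] [CharZero R] (a b : R) :
    IsDFinite (loopGF
      ({((1:ℤ), (0:ℤ)), (-1, 0), (1, 1), (-1, 1), (1, -1), (-1, -1)} : Set (ℤ × ℤ)) a b) := by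
  rw [loopGF_eq_mk_mul]
  refine IsPRecursive.isDFinite (IsPRecursive.mul
    (isPRecursive_pathWeight (e := 0) (fun f => ?_) (fun f k => ?_) b)
    (isPRecursive_pathWeight (e := 1) (fun f => ?_) (fun f k => ?_) a))
  · simp [dyckNeighbors]
  · simp [dyckNeighbors]
  · simp [motzkinNeighbors]
  · simp [motzkinNeighbors, add_assoc]

theorem isDFinite_one {R : Type*} [CommRing R] [Nontrivial R] :
    IsDFinite (1 : PowerSeries R) :=
  isDFinite_of_not_linearIndependent fun h => h.ne_zero 1 derivative_one

end Loops

/-- Model 4 (diagonal plus horizontal steps): `G(t;a,1)` and `G(t;1,b)` are D-finite, and `G(t;a,b)` is a ratio of D-finite series. -/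
theorem model4_dfinite_and_ratio :
    IsDFinite (loopGF ({((1:ℤ), (0:ℤ)), (-1, 0), (1, 1), (-1, 1), (1, -1), (-1, -1)} : Set (ℤ × ℤ)) (Polynomial.X : Polynomial ℚ) 1) ∧
    IsDFinite (loopGF ({((1:ℤ), (0:ℤ)), (-1, 0), (1, 1), (-1, 1), (1, -1), (-1, -1)} : Set (ℤ × ℤ)) (1 : Polynomial ℚ) Polynomial.X) ∧
    ∃ F H : PowerSeries (MvPolynomial (Fin 2) ℚ),
      IsDFinite F ∧ IsDFinite H ∧ H ≠ 0 ∧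
      H * loopGF ({((1:ℤ), (0:ℤ)), (-1, 0), (1, 1), (-1, 1), (1, -1), (-1, -1)} : Set (ℤ × ℤ))
        (MvPolynomial.X (0 : Fin 2)) (MvPolynomial.X (1 : Fin 2)) = F := by
  exact ⟨isDFinite_loopGF _ _, isDFinite_loopGF _ _, _, 1, isDFinite_loopGF _ _, isDFinite_one,
    one_ne_zero, one_mul _⟩
end

section
/- Let S = {(1,1),(1,−1),(−1,1),(−1,−1)} (the diagonal walk, Model 2). For all n, h, v ≥ 0, the number of quarter-plane loops of length n with steps in S having exactly h visits to the horizontal boundary and exactly v visits to the vertical boundary equals D(n,h)·D(n,v), where D(n,k) is the number of Dyck-type paths of length n with exactly k returns to zero. -/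
open PowerSeries

/-- The number of quarter-plane loops of length `n` with steps in `S` having exactly
`h` visits to the horizontal boundary and `v` visits to the vertical boundary. -/
noncomputable def loopCount (S : Set (ℤ × ℤ)) (n h v : ℕ) : ℕ :=
  Nat.card {w : Fin (n + 1) → ℕ × ℕ //
    IsQPLoop S n w ∧ hvisits w = h ∧ vvisits w = v}

/-- A Dyck-type path of length `n`: a sequence of non-negative integers starting and
ending at `0` with steps of absolute value `1`. -/
def IsDyckPath (n : ℕ) (s : Fin (n + 1) → ℕ) : Prop :=
  s 0 = 0 ∧ s (Fin.last n) = 0 ∧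
    ∀ i : Fin n, ((s i.succ : ℤ) - (s i.castSucc : ℤ)).natAbs = 1

/-- The number of returns to zero of a Dyck-type path: indices `1 ≤ i ≤ n` with `s i = 0`. -/
def dyckReturns {n : ℕ} (s : Fin (n + 1) → ℕ) : ℕ :=
  (Finset.univ.filter fun i : Fin (n + 1) => 0 < (i : ℕ) ∧ s i = 0).card

/-- `dyckCount n k` is the number of Dyck-type paths of length `n` with exactly `k`
returns to zero. -/
noncomputable def dyckCount (n k : ℕ) : ℕ :=
  Nat.card {s : Fin (n + 1) → ℕ // IsDyckPath n s ∧ dyckReturns s = k}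

theorem isQPLoop_diagonal_iff {n : ℕ} {w : Fin (n + 1) → ℕ × ℕ} :
    IsQPLoop ({((1:ℤ), (1:ℤ)), (1, -1), (-1, 1), (-1, -1)} : Set (ℤ × ℤ)) n w ↔
      IsDyckPath n (fun i => (w i).2) ∧ IsDyckPath n (fun i => (w i).1) := by
  have hstep (x y : ℤ) :
      (x, y) ∈ ({((1:ℤ), (1:ℤ)), (1, -1), (-1, 1), (-1, -1)} : Set (ℤ × ℤ)) ↔
        y.natAbs = 1 ∧ x.natAbs = 1 := by
    simp only [Set.mem_insert_iff, Set.mem_singleton_iff, Prod.mk.injEq]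
    omega
  simp only [IsQPLoop, IsDyckPath, hstep, forall_and, Prod.ext_iff]
  tauto

/-- Diagonal loops with prescribed boundary visits correspond to pairs of Dyck-type paths
with prescribed returns. -/
def diagonalLoopEquiv (n h v : ℕ) :
    {w : Fin (n + 1) → ℕ × ℕ //
      IsQPLoop ({((1:ℤ), (1:ℤ)), (1, -1), (-1, 1), (-1, -1)} : Set (ℤ × ℤ)) n w ∧
        hvisits w = h ∧ vvisits w = v} ≃
    {s : Fin (n + 1) → ℕ // IsDyckPath n s ∧ dyckReturns s = h} ×
      {s : Fin (n + 1) → ℕ // IsDyckPath n s ∧ dyckReturns s = v} where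
  toFun w :=
    (⟨fun i => (w.1 i).2, (isQPLoop_diagonal_iff.1 w.2.1).1, w.2.2.1⟩,
      ⟨fun i => (w.1 i).1, (isQPLoop_diagonal_iff.1 w.2.1).2, w.2.2.2⟩)
  invFun p :=
    ⟨fun i => (p.2.1 i, p.1.1 i), isQPLoop_diagonal_iff.2 ⟨p.1.2.1, p.2.2.1⟩,
      p.1.2.2, p.2.2.2⟩
  left_inv _ := rfl
  right_inv _ := rfl

/-- Model 2 (the diagonal walk): loops factor into a pair of independent Dyck-type paths,
so the refined loop counts are products of Dyck-path counts. -/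
theorem model2_loopCount_eq_dyck_product :
    ∀ n h v : ℕ,
      loopCount ({((1:ℤ), (1:ℤ)), (1, -1), (-1, 1), (-1, -1)} : Set (ℤ × ℤ)) n h v = dyckCount n h * dyckCount n v := by
  intro n h v
  exact (Nat.card_congr (diagonalLoopEquiv n h v)).trans (Nat.card_prod _ _)
end

section
/- For all integers n ≥ 1 and 1 ≤ k ≤ n, the number of Dyck-type paths of length 2n with exactly k returns to zero is D(2n,k) = (k/n)·binomial(2n−k−1, n−k). -/
theorem dyckReturns_eq_sum {n : ℕ} (s : Fin (n + 1) → ℕ) :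
    dyckReturns s = ∑ i : Fin n, if s i.succ = 0 then 1 else 0 := by
  rw [dyckReturns, Finset.card_filter, Fin.sum_univ_succ]
  simp

theorem dyckReturns_cons {n : ℕ} (h : ℕ) (t : Fin (n + 1) → ℕ) :
    dyckReturns (Fin.cons h t : Fin (n + 2) → ℕ)
      = (if t 0 = 0 then 1 else 0) + dyckReturns t := by
  rw [dyckReturns_eq_sum, dyckReturns_eq_sum, Fin.sum_univ_succ]
  rfl

/-- Non-negative paths of length `n` from height `h` to `0` with `k` visits to `0` after the
starting point. -/
def descentPaths (n h k : ℕ) : Set (Fin (n + 1) → ℕ) :=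
  {s | s 0 = h ∧ s (Fin.last n) = 0 ∧
    (∀ i : Fin n, ((s i.succ : ℤ) - (s i.castSucc : ℤ)).natAbs = 1) ∧ dyckReturns s = k}

theorem dyckCount_eq_ncard (n k : ℕ) : dyckCount n k = (descentPaths n 0 k).ncard := by
  rw [dyckCount, ← Nat.card_coe_set_eq]
  apply Nat.card_congr
  apply Equiv.subtypeEquivRight
  intro s
  simp only [IsDyckPath, descentPaths, Set.mem_ofPred_eq, and_assoc]

theorem cons_mem_descentPaths {n h h' k : ℕ} {t : Fin (n + 1) → ℕ} :
    (Fin.cons h' t : Fin (n + 2) → ℕ) ∈ descentPaths (n + 1) h k ↔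
      h' = h ∧ ((t 0 : ℤ) - h).natAbs = 1 ∧
        ∃ j, j + (if t 0 = 0 then 1 else 0) = k ∧ t ∈ descentPaths n (t 0) j := by
  simp only [descentPaths, Set.mem_ofPred_eq, Fin.cons_zero, ← Fin.succ_last, Fin.cons_succ,
    dyckReturns_cons, Fin.forall_fin_succ (n := n), Fin.castSucc_zero, ← Fin.succ_castSucc]
  constructor
  · rintro ⟨rfl, h2, ⟨h3, h4⟩, h5⟩
    exact ⟨rfl, h3, _, by omega, trivial, h2, h4, rfl⟩
  · rintro ⟨rfl, h3, j, h5, -, h2, h4, rfl⟩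
    exact ⟨rfl, h2, ⟨h3, h4⟩, by omega⟩

theorem zero_eq_of_mem_descentPaths {n h k : ℕ} {t : Fin (n + 1) → ℕ}
    (ht : t ∈ descentPaths n h k) : t 0 = h := ht.1

theorem descentPaths_succ_zero (n k : ℕ) :
    descentPaths (n + 1) 0 k = Fin.cons 0 '' descentPaths n 1 k := by
  ext s
  induction s using Fin.consCases with
  | _ h' t =>
  rw [cons_mem_descentPaths]
  constructor
  · rintro ⟨rfl, h1, j, hj, hm⟩
    have h0 : t 0 = 1 := by omega
    rw [h0] at hj hm
    exact ⟨t, by simpa [← hj] using hm, rfl⟩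
  · rintro ⟨t', ht, he⟩
    obtain ⟨rfl, rfl⟩ := Fin.cons_injective2 he
    have h0 := zero_eq_of_mem_descentPaths ht
    exact ⟨rfl, by simp [h0], k, by simp [h0], by rwa [h0]⟩

theorem descentPaths_succ_one_zero (n : ℕ) :
    descentPaths (n + 1) 1 0 = Fin.cons 1 '' descentPaths n 2 0 := by
  ext s
  induction s using Fin.consCases with
  | _ h' t =>
  rw [cons_mem_descentPaths]
  constructor
  · rintro ⟨rfl, h1, j, hj, hm⟩
    have h0 : t 0 = 2 := by
      split_ifs at hj
      omega
    rw [h0] at hj hm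
    obtain rfl : j = 0 := by omega
    exact ⟨t, hm, rfl⟩
  · rintro ⟨t', ht, he⟩
    obtain ⟨rfl, rfl⟩ := Fin.cons_injective2 he
    have h0 := zero_eq_of_mem_descentPaths ht
    exact ⟨rfl, by simp [h0], 0, by simp [h0], by rwa [h0]⟩

theorem descentPaths_succ_one_succ (n k : ℕ) :
    descentPaths (n + 1) 1 (k + 1)
      = Fin.cons 1 '' (descentPaths n 0 k ∪ descentPaths n 2 (k + 1)) := by
  ext s
  induction s using Fin.consCases with
  | _ h' t =>
  rw [cons_mem_descentPaths]
  constructor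
  · rintro ⟨rfl, h1, j, hj, hm⟩
    refine ⟨t, ?_, rfl⟩
    obtain h0 | h0 : t 0 = 0 ∨ t 0 = 2 := by omega
    · rw [h0] at hj hm
      left
      obtain rfl : j = k := by simpa using hj
      exact hm
    · rw [h0] at hj hm
      right
      simpa [← hj] using hm
  · rintro ⟨t', ht, he⟩
    obtain ⟨rfl, rfl⟩ := Fin.cons_injective2 he
    rcases ht with ht | ht
    · have h0 := zero_eq_of_mem_descentPaths ht
      exact ⟨rfl, by simp [h0], k, by simp [h0], by rwa [h0]⟩
    · have h0 := zero_eq_of_mem_descentPaths ht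
      exact ⟨rfl, by simp [h0], k + 1, by simp [h0], by rwa [h0]⟩

theorem descentPaths_succ_add_two (n h k : ℕ) :
    descentPaths (n + 1) (h + 2) k
      = Fin.cons (h + 2) '' (descentPaths n (h + 1) k ∪ descentPaths n (h + 3) k) := by
  ext s
  induction s using Fin.consCases with
  | _ h' t =>
  rw [cons_mem_descentPaths]
  constructor
  · rintro ⟨rfl, h1, j, hj, hm⟩
    refine ⟨t, ?_, rfl⟩
    obtain h0 | h0 : t 0 = h + 1 ∨ t 0 = h + 3 := by omega
    · rw [h0] at hj hm
      left
      simpa [← hj] using hm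
    · rw [h0] at hj hm
      right
      simpa [← hj] using hm
  · rintro ⟨t', ht, he⟩
    obtain ⟨rfl, rfl⟩ := Fin.cons_injective2 he
    rcases ht with ht | ht <;>
    · have h0 := zero_eq_of_mem_descentPaths ht
      exact ⟨rfl, by rw [h0]; push_cast; omega, k, by simp [h0], by rwa [h0]⟩

theorem descentPaths_zero (h k : ℕ) :
    descentPaths 0 h k = if h = 0 ∧ k = 0 then {fun _ => 0} else ∅ := by
  ext s
  have hs : s = (fun _ => 0) ↔ s 0 = 0 := by
    simp [funext_iff]
  split_ifs with hc
  · simp [descentPaths, dyckReturns_eq_sum, hc, hs]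
  · simp only [descentPaths, dyckReturns_eq_sum, Set.mem_ofPred_eq, Set.mem_empty_iff_false,
      iff_false]
    rintro ⟨h1, h2, -, h3⟩
    exact hc ⟨h1.symm.trans h2, by simpa using h3.symm⟩

theorem finite_descentPaths (n h k : ℕ) : (descentPaths n h k).Finite := by
  induction n generalizing h k with
  | zero => rw [descentPaths_zero]; split_ifs <;> simp
  | succ n ih =>
    match h, k with
    | 0, k => rw [descentPaths_succ_zero]; exact (ih _ _).image _
    | 1, 0 => rw [descentPaths_succ_one_zero]; exact (ih _ _).image _
    | 1, k + 1 =>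
      rw [descentPaths_succ_one_succ]; exact ((ih _ _).union (ih _ _)).image _
    | h + 2, k =>
      rw [descentPaths_succ_add_two]; exact ((ih _ _).union (ih _ _)).image _

theorem disjoint_descentPaths {n h h' k k' : ℕ} (hne : h ≠ h') :
    Disjoint (descentPaths n h k) (descentPaths n h' k') :=
  Set.disjoint_left.2 fun _ ht ht' => hne (ht.1.symm.trans ht'.1)

theorem ncard_descentPaths_succ_zero (n k : ℕ) :
    (descentPaths (n + 1) 0 k).ncard = (descentPaths n 1 k).ncard := by
  rw [descentPaths_succ_zero, Set.ncard_image_of_injective _ (Fin.cons_right_injective _)]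

theorem ncard_descentPaths_succ_one_succ (n k : ℕ) :
    (descentPaths (n + 1) 1 (k + 1)).ncard
      = (descentPaths n 0 k).ncard + (descentPaths n 2 (k + 1)).ncard := by
  rw [descentPaths_succ_one_succ, Set.ncard_image_of_injective _ (Fin.cons_right_injective _),
    Set.ncard_union_eq (disjoint_descentPaths (by omega)) (finite_descentPaths _ _ _)
      (finite_descentPaths _ _ _)]

theorem ncard_descentPaths_succ_add_two (n h k : ℕ) :
    (descentPaths (n + 1) (h + 2) k).ncard
      = (descentPaths n (h + 1) k).ncard + (descentPaths n (h + 3) k).ncard := by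
  rw [descentPaths_succ_add_two, Set.ncard_image_of_injective _ (Fin.cons_right_injective _),
    Set.ncard_union_eq (disjoint_descentPaths (by omega)) (finite_descentPaths _ _ _)
      (finite_descentPaths _ _ _)]

theorem descentPaths_succ_right_zero (n h : ℕ) : descentPaths n (h + 1) 0 = ∅ := by
  induction n generalizing h with
  | zero => simp [descentPaths_zero]
  | succ n ih =>
    match h with
    | 0 => rw [descentPaths_succ_one_zero, ih, Set.image_empty]
    | h + 1 => rw [descentPaths_succ_add_two, ih, ih, Set.union_empty, Set.image_empty]

theorem descentPaths_eq_empty {n k : ℕ} (hnk : n < k) (h : ℕ) : descentPaths n h k = ∅ := by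
  rw [Set.eq_empty_iff_forall_notMem]
  rintro s ⟨-, -, -, hs⟩
  have : dyckReturns s ≤ n := by
    rw [dyckReturns_eq_sum]
    calc _ ≤ ∑ _i : Fin n, 1 := Finset.sum_le_sum fun i _ => by split_ifs <;> simp
      _ = n := by simp
  omega

/-- The number of paths of length `m` from height `a` that reach `0` for the first time at the
end. -/
def firstPassage : ℕ → ℕ → ℕ
  | 0, 0 => 1
  | 0, _ + 1 => 0
  | _ + 1, 0 => 0
  | m + 1, a + 1 => firstPassage m a + firstPassage m (a + 2)

/-- Deleting the first step of each excursion turns a path with several returns into a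
first-passage path. -/
theorem ncard_descentPaths (N : ℕ) :
    (∀ n k, n + k = N → (descentPaths N 0 k).ncard = firstPassage n k) ∧
    (∀ n k h, n + k = N →
      (descentPaths N (h + 1) (k + 1)).ncard = firstPassage n (h + 1 + k)) := by
  induction N with
  | zero =>
    refine ⟨fun n k hN => ?_, fun n k h hN => ?_⟩ <;>
    · obtain ⟨rfl, rfl⟩ : n = 0 ∧ k = 0 := by omega
      simp [descentPaths_zero, firstPassage]
  | succ N ih =>
    obtain ⟨ih0, ih1⟩ := ih
    refine ⟨fun n k hN => ?_, fun n k h hN => ?_⟩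
    · rw [ncard_descentPaths_succ_zero]
      match k with
      | 0 =>
        obtain rfl : n = N + 1 := by omega
        rw [descentPaths_succ_right_zero N 0]
        simp [firstPassage]
      | k + 1 =>
        rw [ih1 n k 0 (by omega)]
        congr 1
        omega
    · match n with
      | 0 =>
        rw [descentPaths_eq_empty (by omega), show h + 1 + k = (h + k) + 1 by omega]
        simp [firstPassage]
      | n + 1 =>
        rw [show h + 1 + k = (h + k) + 1 by omega, firstPassage]
        match h with
        | 0 =>
          rw [ncard_descentPaths_succ_one_succ, ih0 n k (by omega), ih1 n k 1 (by omega)]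
          congr 2 <;> omega
        | h + 1 =>
          rw [ncard_descentPaths_succ_add_two, ih1 n k h (by omega),
            ih1 n k (h + 2) (by omega)]
          congr 2
          omega

theorem firstPassage_eq_zero {m a : ℕ} (hma : m < a) : firstPassage m a = 0 := by
  induction m generalizing a with
  | zero => obtain ⟨a, rfl⟩ := Nat.exists_eq_add_of_lt hma; simp [firstPassage]
  | succ m ih =>
    obtain ⟨a, rfl⟩ : ∃ b, a = b + 1 := ⟨a - 1, by omega⟩
    rw [firstPassage, ih (by omega), ih (by omega)]

theorem firstPassage_self (a : ℕ) : firstPassage a a = 1 := by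
  induction a with
  | zero => rfl
  | succ a ih => rw [firstPassage, ih, firstPassage_eq_zero (by omega)]

theorem firstPassage_add_choose (a j : ℕ) :
    firstPassage (a + 2 * j + 3) (a + 1) + (a + 2 * j + 2).choose j
      = (a + 2 * j + 2).choose (j + 1) := by
  induction j generalizing a with
  | zero =>
    induction a with
    | zero => decide
    | succ a ih =>
      have h := firstPassage_self (a + 3)
      simp only [mul_zero, add_zero, Nat.choose_zero_right, zero_add, Nat.choose_one_right]
        at ih ⊢
      rw [show a + 1 + 3 = a + 3 + 1 by omega, firstPassage]
      rw [show a + 1 + 2 = a + 3 by omega] at *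
      omega
  | succ j ihj =>
    induction a with
    | zero =>
      have h := ihj 1
      have hs : (2 * j + 3).choose (j + 1 + 1) = (2 * j + 3).choose (j + 1) :=
        Nat.choose_symm_of_eq_add (by omega)
      rw [show 0 + 2 * (j + 1) + 3 = (2 * j + 3) + 1 + 1 by omega,
        show 0 + 2 * (j + 1) + 2 = (2 * j + 3) + 1 by omega, firstPassage, firstPassage,
        Nat.choose_succ_succ', Nat.choose_succ_succ' _ (j + 1)]
      rw [show 1 + 2 * j + 3 = 2 * j + 3 + 1 by omega,
        show 1 + 2 * j + 2 = 2 * j + 3 by omega] at h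
      norm_num at h ⊢
      rw [show 2 * j + 3 + 1 = 2 * j + 4 by omega] at h
      omega
    | succ a iha =>
      have h := ihj (a + 2)
      rw [show a + 1 + 2 * (j + 1) + 3 = (a + 2 * j + 5) + 1 by omega,
        show a + 1 + 2 * (j + 1) + 2 = (a + 2 * j + 4) + 1 by omega, firstPassage,
        Nat.choose_succ_succ', Nat.choose_succ_succ' _ (j + 1)]
      rw [show a + 2 + 2 * j + 3 = a + 2 * j + 5 by omega,
        show a + 2 + 2 * j + 2 = a + 2 * j + 4 by omega] at h
      rw [show a + 2 * (j + 1) + 3 = a + 2 * j + 5 by omega,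
        show a + 2 * (j + 1) + 2 = a + 2 * j + 4 by omega] at iha
      norm_num [add_assoc] at h iha ⊢
      omega

/-- The number of Dyck-type paths of length `2n` with exactly `k` returns to zero is
`(k/n)·binomial(2n−k−1, n−k)`. -/
theorem dyckCount_formula (n k : ℕ) (hn : 1 ≤ n) (hk : 1 ≤ k) (hkn : k ≤ n) :
    (dyckCount (2 * n) k : ℚ)
      = (k : ℚ) / (n : ℚ) * (Nat.choose (2 * n - k - 1) (n - k) : ℚ) := by
  rw [dyckCount_eq_ncard, (ncard_descentPaths (2 * n)).1 (2 * n - k) k (by omega)]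
  obtain ⟨a, rfl⟩ : ∃ a, k = a + 1 := ⟨k - 1, by omega⟩
  obtain ⟨i, rfl⟩ := Nat.exists_eq_add_of_le hkn
  match i with
  | 0 =>
    rw [show 2 * (a + 1 + 0) - (a + 1) = a + 1 by omega, firstPassage_self]
    simp
    field_simp
  | j + 1 =>
    rw [show 2 * (a + 1 + (j + 1)) - (a + 1) = a + 2 * j + 3 by omega,
      show a + 2 * j + 3 - 1 = a + 2 * j + 2 by omega,
      show a + 1 + (j + 1) - (a + 1) = j + 1 by omega]
    have h : (firstPassage (a + 2 * j + 3) (a + 1) : ℚ) + (a + 2 * j + 2).choose j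
        = (a + 2 * j + 2).choose (j + 1) := by
      exact_mod_cast firstPassage_add_choose a j
    have h2 : ((a + 2 * j + 2).choose (j + 1) : ℚ) * (j + 1)
        = (a + 2 * j + 2).choose j * (a + j + 2) := by
      have := Nat.choose_succ_right_eq (a + 2 * j + 2) j
      rw [show a + 2 * j + 2 - j = a + j + 2 by omega] at this
      exact_mod_cast this
    have hpos : (a : ℚ) + 1 + (j + 1) ≠ 0 := by positivity
    push_cast
    field_simp
    linear_combination (a + j + 2 : ℚ) * h + h2
end

section
/- Let S ⊆ {−1,0,1}²∖{(0,0)} be any step set that is invariant under the horizontal reflection (i,j) ↦ (−i,j). Then the interacting generating function with trivial vertical-boundary weight, G_S(t;a,1) ∈ ℚ[a][[t]], is D-finite. (This covers Models 1 through 16 of the paper.) -/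
open PowerSeries

namespace QuarterPlane

variable {R : Type*} [CommRing R]

/-- Power series in `t` whose coefficients are Laurent polynomials in `x`. -/
abbrev LSeries2 (R : Type*) [CommRing R] := PowerSeries (LaurentPolynomial R)

/-- The derivative of Laurent polynomials, as a linear map. -/
noncomputable def laurentDerivLin : LaurentPolynomial R →ₗ[R] LaurentPolynomial R where
  toFun f := f.coeff.sum fun n c => AddMonoidAlgebra.single (n - 1) ((n : R) * c)
  map_add' f g := by
    rw [AddMonoidAlgebra.coeff_add, Finsupp.sum_add_index'] <;> simp [mul_add]
  map_smul' r f := by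
    rw [AddMonoidAlgebra.coeff_smul, Finsupp.sum_smul_index', Finsupp.smul_sum]
    · refine Finsupp.sum_congr fun n _ => ?_
      rw [AddMonoidAlgebra.smul_single, RingHom.id_apply, smul_eq_mul, smul_eq_mul]
      ring_nf
    · simp

theorem laurentDerivLin_single (n : ℤ) (c : R) :
    laurentDerivLin (.single n c) = .single (n - 1) ((n : R) * c) := by
  simp only [laurentDerivLin, LinearMap.coe_mk, AddHom.coe_mk, AddMonoidAlgebra.coeff_single]
  rw [Finsupp.sum_single_index]
  simp

theorem laurentDerivLin_leibniz (f g : LaurentPolynomial R) :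
    laurentDerivLin (f * g) = f • laurentDerivLin g + g • laurentDerivLin f := by
  induction f using LaurentPolynomial.induction_on' with
  | add p q hp hq => rw [add_mul, map_add, hp, hq, map_add]; simp only [smul_eq_mul]; ring
  | C_mul_T n a =>
    induction g using LaurentPolynomial.induction_on' with
    | add p q hp hq => rw [mul_add, map_add, hp, hq, map_add]; simp only [smul_eq_mul]; ring
    | C_mul_T m b =>
      simp only [← LaurentPolynomial.single_eq_C_mul_T, AddMonoidAlgebra.single_mul_single,
        laurentDerivLin_single, smul_eq_mul]
      rw [show n + (m - 1) = n + m - 1 by ring, show m + (n - 1) = n + m - 1 by ring,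
        ← AddMonoidAlgebra.single_add]
      congr 1
      push_cast
      ring

theorem coeff_laurentDerivLin (f : LaurentPolynomial R) (e : ℤ) :
    (laurentDerivLin f).coeff e = ((e : R) + 1) * f.coeff (e + 1) := by
  induction f using LaurentPolynomial.induction_on' with
  | add p q hp hq => simp [hp, hq, mul_add]
  | C_mul_T n a =>
    rw [← LaurentPolynomial.single_eq_C_mul_T, laurentDerivLin_single]
    simp only [AddMonoidAlgebra.coeff_single, Finsupp.single_apply]
    by_cases h : n = e + 1
    · subst h; simp
    · rw [if_neg (by omega), if_neg h, mul_zero]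

/-- The derivation `∂/∂x`. -/
noncomputable def dx : Derivation R (LSeries2 R) (LSeries2 R) :=
  Derivation.mk'
    { toFun := fun f => PowerSeries.mk fun n => laurentDerivLin (coeff n f)
      map_add' := fun f g => by ext1 n; simp
      map_smul' := fun r f => by ext1 n; simp }
    (fun f g => by
      ext1 n
      simp only [LinearMap.coe_mk, AddHom.coe_mk, coeff_mk, smul_eq_mul, map_add, coeff_mul,
        map_sum, laurentDerivLin_leibniz, Finset.sum_add_distrib]
      congr 1
      rw [← Finset.Nat.sum_antidiagonal_swap]
      rfl)

theorem coeff_dx (f : LSeries2 R) (n : ℕ) : coeff n (dx f) = laurentDerivLin (coeff n f) := by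
  simp [dx]

/-- The derivation `∂/∂t`. -/
noncomputable def dt : Derivation R (LSeries2 R) (LSeries2 R) :=
  (PowerSeries.derivative (LaurentPolynomial R)).restrictScalars R

theorem coeff_dt (f : LSeries2 R) (n : ℕ) : coeff n (dt f) = coeff (n + 1) f * (n + 1) :=
  coeff_derivative f n

/-- The monomial `x ^ i * t ^ j`. -/
noncomputable def mon (i : ℤ) (j : ℕ) : LSeries2 R :=
  PowerSeries.monomial j (LaurentPolynomial.T i)

theorem mon_mul_mon (i i' : ℤ) (j j' : ℕ) :
    (mon i j : LSeries2 R) * mon i' j' = mon (i + i') (j + j') := by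
  rw [mon, mon, monomial_mul_monomial, ← LaurentPolynomial.T_add, mon]

theorem dx_mon (i : ℤ) (j : ℕ) : dx (mon i j : LSeries2 R) = (i : R) • mon (i - 1) j := by
  ext1 n
  rw [coeff_dx, mon, mon, PowerSeries.coeff_smul, coeff_monomial, coeff_monomial]
  split_ifs
  · rw [LaurentPolynomial.T, laurentDerivLin_single, LaurentPolynomial.T,
      AddMonoidAlgebra.smul_single]
    simp
  · simp

theorem dt_mon (i : ℤ) (j : ℕ) : dt (mon i j : LSeries2 R) = (j : R) • mon i (j - 1) := by
  ext1 n
  rw [coeff_dt, mon, mon, PowerSeries.coeff_smul, coeff_monomial, coeff_monomial]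
  rcases j with _ | j
  · simp
  · by_cases h : n = j
    · subst h
      simp [LaurentPolynomial.smul_eq_C_mul]
    · simp [h]

/-- The monomials `x ^ i * t ^ j` with `|i| ≤ n` and `j ≤ n`. -/
noncomputable def monSet (R : Type*) [CommRing R] (n : ℕ) : Finset (LSeries2 R) :=
  by classical exact (Finset.Icc (-n : ℤ) n ×ˢ Finset.range (n + 1)).image fun q => mon q.1 q.2

theorem mem_monSet {n : ℕ} {f : LSeries2 R} :
    f ∈ monSet R n ↔ ∃ (i : ℤ) (j : ℕ), (-n ≤ i ∧ i ≤ n) ∧ j ≤ n ∧ mon i j = f := by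
  simp [monSet, and_assoc]

theorem card_monSet_le (n : ℕ) : (monSet R n).card ≤ (2 * n + 1) * (n + 1) := by
  classical
  refine Finset.card_image_le.trans ?_
  rw [Finset.card_product, Int.card_Icc, Finset.card_range]
  exact Nat.mul_le_mul_right _ (by omega)

/-- Laurent polynomials in `x` and `t` with bounded exponents. -/
noncomputable def boundedPoly (R : Type*) [CommRing R] (n : ℕ) : Submodule R (LSeries2 R) :=
  Submodule.span R (monSet R n)

theorem mon_mem {i : ℤ} {j n : ℕ} (h₁ : -n ≤ i) (h₂ : i ≤ n) (h₃ : j ≤ n) :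
    (mon i j : LSeries2 R) ∈ boundedPoly R n :=
  Submodule.subset_span (mem_monSet.2 ⟨i, j, ⟨h₁, h₂⟩, h₃, rfl⟩)

theorem boundedPoly_mono {m n : ℕ} (h : m ≤ n) : boundedPoly R m ≤ boundedPoly R n := by
  refine Submodule.span_le.2 fun f hf => ?_
  obtain ⟨i, j, hi, hj, rfl⟩ := mem_monSet.1 hf
  exact mon_mem (by omega) (by omega) (by omega)

theorem mul_mem_boundedPoly {m n : ℕ} {f g : LSeries2 R} (hf : f ∈ boundedPoly R m)
    (hg : g ∈ boundedPoly R n) : f * g ∈ boundedPoly R (m + n) := by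
  have h := Submodule.mul_mem_mul hf hg
  rw [boundedPoly, boundedPoly, Submodule.span_mul_span] at h
  refine Submodule.span_le.2 ?_ h
  rintro _ ⟨f, hf, g, hg, rfl⟩
  obtain ⟨i, j, hi, hj, rfl⟩ := mem_monSet.1 hf
  obtain ⟨i', j', hi', hj', rfl⟩ := mem_monSet.1 hg
  simp only [mon_mul_mon]
  exact mon_mem (by push_cast; omega) (by push_cast; omega) (by omega)

theorem dx_mem_boundedPoly {n : ℕ} {f : LSeries2 R} (hf : f ∈ boundedPoly R n) :
    dx f ∈ boundedPoly R (n + 1) := by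
  have : boundedPoly R n ≤ (boundedPoly R (n + 1)).comap (dx (R := R)).toLinearMap := by
    refine Submodule.span_le.2 fun f hf => ?_
    obtain ⟨i, j, hi, hj, rfl⟩ := mem_monSet.1 hf
    simp only [Submodule.comap_coe, Set.mem_preimage, Derivation.coeFn_coe, dx_mon, SetLike.mem_coe]
    exact Submodule.smul_mem _ _ (mon_mem (by push_cast; omega) (by push_cast; omega) (by omega))
  exact this hf

theorem dt_mem_boundedPoly {n : ℕ} {f : LSeries2 R} (hf : f ∈ boundedPoly R n) :
    dt f ∈ boundedPoly R (n + 1) := by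
  have : boundedPoly R n ≤ (boundedPoly R (n + 1)).comap (dt (R := R)).toLinearMap := by
    refine Submodule.span_le.2 fun f hf => ?_
    obtain ⟨i, j, hi, hj, rfl⟩ := mem_monSet.1 hf
    simp only [Submodule.comap_coe, Set.mem_preimage, Derivation.coeFn_coe, dt_mon, SetLike.mem_coe]
    exact Submodule.smul_mem _ _ (mon_mem (by push_cast; omega) (by push_cast; omega) (by omega))
  exact this hf

/-- The subring of Laurent polynomials in `x` and (ordinary) polynomials in `t`. -/
noncomputable def polySubring (R : Type*) [CommRing R] : Subring (LSeries2 R) where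
  carrier := {f | ∃ n, f ∈ boundedPoly R n}
  mul_mem' := fun ⟨m, hm⟩ ⟨n, hn⟩ => ⟨m + n, mul_mem_boundedPoly hm hn⟩
  one_mem' := ⟨0, by
    have : (1 : LSeries2 R) = mon 0 0 := by
      simp [mon]
    rw [this]
    exact mon_mem (by simp) (by simp) le_rfl⟩
  add_mem' := fun ⟨m, hm⟩ ⟨n, hn⟩ => ⟨max m n, Submodule.add_mem _
    (boundedPoly_mono (le_max_left _ _) hm) (boundedPoly_mono (le_max_right _ _) hn)⟩
  zero_mem' := ⟨0, Submodule.zero_mem _⟩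
  neg_mem' := fun ⟨m, hm⟩ => ⟨m, Submodule.neg_mem _ hm⟩

theorem mon_mem_polySubring (i : ℤ) (j : ℕ) : (mon i j : LSeries2 R) ∈ polySubring R :=
  ⟨i.natAbs + j, mon_mem (by omega) (by omega) (by omega)⟩

theorem smul_mem_polySubring (r : R) {f : LSeries2 R} (hf : f ∈ polySubring R) :
    r • f ∈ polySubring R :=
  let ⟨n, hn⟩ := hf; ⟨n, Submodule.smul_mem _ _ hn⟩

theorem dx_mem_polySubring {f : LSeries2 R} (hf : f ∈ polySubring R) : dx f ∈ polySubring R :=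
  let ⟨n, hn⟩ := hf; ⟨n + 1, dx_mem_boundedPoly hn⟩

theorem dt_mem_polySubring {f : LSeries2 R} (hf : f ∈ polySubring R) : dt f ∈ polySubring R :=
  let ⟨n, hn⟩ := hf; ⟨n + 1, dt_mem_boundedPoly hn⟩

theorem mon_zero_left (i : ℕ) : (mon 0 i : LSeries2 R) = X ^ i := by
  rw [mon, LaurentPolynomial.T_zero, X_pow_eq]

theorem pow_mem_boundedPoly {P : LSeries2 R} {c : ℕ} (hP : P ∈ boundedPoly R c) (k : ℕ) :
    P ^ k ∈ boundedPoly R (k * c) := by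
  induction k with
  | zero =>
    rw [pow_zero, ← pow_zero X, ← mon_zero_left]
    exact mon_mem (by simp) (by simp) (by simp)
  | succ k ih =>
    rw [pow_succ, add_mul, one_mul]
    exact mul_mem_boundedPoly ih hP

/-- The module of `p + q * s` with `p`, `q` Laurent polynomials with bounded exponents. -/
noncomputable def boundedExt (s : LSeries2 R) (n : ℕ) : Submodule R (LSeries2 R) :=
  boundedPoly R n ⊔ (boundedPoly R n).map (LinearMap.mulRight R s)

theorem mem_boundedExt {s f : LSeries2 R} {n : ℕ} :
    f ∈ boundedExt s n ↔ ∃ p ∈ boundedPoly R n, ∃ q ∈ boundedPoly R n, p + q * s = f := by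
  simp [boundedExt, Submodule.mem_sup]

theorem exists_span_boundedExt (s : LSeries2 R) (n : ℕ) :
    ∃ W : Finset (LSeries2 R), boundedExt s n = Submodule.span R (W : Set (LSeries2 R)) ∧
      W.card ≤ 2 * ((2 * n + 1) * (n + 1)) := by
  classical
  refine ⟨monSet R n ∪ (monSet R n).image (LinearMap.mulRight R s), ?_, ?_⟩
  · rw [Finset.coe_union, Submodule.span_union, Finset.coe_image, Submodule.span_image]
    rfl
  · have h₁ := Finset.card_union_le (monSet R n) ((monSet R n).image (LinearMap.mulRight R s))
    have h₂ := Finset.card_image_le (s := monSet R n) (f := LinearMap.mulRight R s)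
    have h₃ := card_monSet_le (R := R) n
    omega

theorem mul_mem_boundedExt {s f g : LSeries2 R} {m n : ℕ} (hf : f ∈ boundedPoly R m)
    (hg : g ∈ boundedExt s n) : f * g ∈ boundedExt s (m + n) := by
  obtain ⟨p, hp, q, hq, rfl⟩ := mem_boundedExt.1 hg
  exact mem_boundedExt.2 ⟨_, mul_mem_boundedPoly hf hp, _, mul_mem_boundedPoly hf hq, by ring⟩

theorem boundedExt_mono {s : LSeries2 R} {m n : ℕ} (h : m ≤ n) :
    boundedExt s m ≤ boundedExt s n :=
  sup_le_sup (boundedPoly_mono h) (Submodule.map_mono (boundedPoly_mono h))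

theorem deriv_mem_boundedExt {s P g f : LSeries2 R} {c M n : ℕ}
    (δ : Derivation R (LSeries2 R) (LSeries2 R))
    (hδ : ∀ {n : ℕ} {f : LSeries2 R}, f ∈ boundedPoly R n → δ f ∈ boundedPoly R (n + 1))
    (hP : P ∈ boundedPoly R c) (hg : g ∈ boundedPoly R c) (hs : P * δ s = g * s)
    (hf : P ^ M * f ∈ boundedExt s n) : P ^ (M + 1) * δ f ∈ boundedExt s (n + (c + 1)) := by
  obtain ⟨p, hp, q, hq, hpq⟩ := mem_boundedExt.1 hf
  have h₁ : P * δ (P ^ M * f) = P ^ (M + 1) * δ f + (M : R) • (δ P * (p + q * s)) := by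
    have hpow : P * δ (P ^ M) = (M : R) • (P ^ M * δ P) := by
      rw [Derivation.leibniz_pow]
      rcases M with _ | M
      · simp
      · simp only [Nat.add_sub_cancel, nsmul_eq_mul, smul_eq_mul, Algebra.smul_def, map_natCast]
        ring
    rw [Derivation.leibniz, smul_eq_mul, smul_eq_mul, mul_add, mul_left_comm P f, hpow, hpq]
    simp only [Algebra.smul_def]
    ring
  have h₂ : P ^ (M + 1) * δ f = P * δ p + (P * δ q + g * q) * s
      - (M : R) • (δ P * (p + q * s)) := by
    rw [eq_sub_iff_add_eq, ← h₁, ← hpq]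
    simp only [map_add, Derivation.leibniz, smul_eq_mul]
    linear_combination q * hs
  rw [h₂]
  refine Submodule.sub_mem _ (mem_boundedExt.2 ⟨_, ?_, _, ?_, rfl⟩) (Submodule.smul_mem _ _ ?_)
  · exact boundedPoly_mono (by omega) (mul_mem_boundedPoly hP (hδ hp))
  · exact Submodule.add_mem _ (boundedPoly_mono (by omega) (mul_mem_boundedPoly hP (hδ hq)))
      (boundedPoly_mono (by omega) (mul_mem_boundedPoly hg hq))
  · exact boundedExt_mono (by omega) (mul_mem_boundedExt (hδ hP) (mem_boundedExt.2 ⟨p, hp, q, hq, rfl⟩))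

theorem iterate_mem_boundedExt {s P g f : LSeries2 R} {c M n : ℕ}
    (δ : Derivation R (LSeries2 R) (LSeries2 R))
    (hδ : ∀ {n : ℕ} {f : LSeries2 R}, f ∈ boundedPoly R n → δ f ∈ boundedPoly R (n + 1))
    (hP : P ∈ boundedPoly R c) (hg : g ∈ boundedPoly R c) (hs : P * δ s = g * s)
    (hf : P ^ M * f ∈ boundedExt s n) (k : ℕ) :
    P ^ (M + k) * δ^[k] f ∈ boundedExt s (n + k * (c + 1)) := by
  induction k with
  | zero => simpa using hf
  | succ k ih =>
    rw [Function.iterate_succ_apply', ← add_assoc,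
      show n + (k + 1) * (c + 1) = n + k * (c + 1) + (c + 1) by ring]
    exact deriv_mem_boundedExt δ hδ hP hg hs ih

/-- The coefficient of `x ^ e`, as a power series in `t`. -/
noncomputable def coeffX (e : ℤ) : LSeries2 R →ₗ[R] PowerSeries R where
  toFun f := PowerSeries.mk fun n => (coeff n f).coeff e
  map_add' f g := by ext n; simp
  map_smul' r f := by ext n; simp

theorem coeff_coeffX (e : ℤ) (f : LSeries2 R) (n : ℕ) :
    coeff n (coeffX e f) = (coeff n f).coeff e := by
  simp [coeffX]

theorem coeffX_X_mul (e : ℤ) (f : LSeries2 R) : coeffX e (X * f) = X * coeffX e f := by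
  ext n
  rcases n with _ | n <;> simp [coeff_coeffX, coeff_zero_X_mul, coeff_succ_X_mul]

theorem coeffX_X_pow_mul (e : ℤ) (f : LSeries2 R) (i : ℕ) :
    coeffX e (X ^ i * f) = X ^ i * coeffX e f := by
  induction i with
  | zero => simp
  | succ i ih => rw [pow_succ', mul_assoc, coeffX_X_mul, ih, pow_succ', mul_assoc]

theorem coeffX_dt_iterate (e : ℤ) (f : LSeries2 R) (j : ℕ) :
    coeffX e (dt^[j] f) = derivativeFun^[j] (coeffX e f) := by
  induction j with
  | zero => rfl
  | succ j ih =>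
    rw [Function.iterate_succ_apply', Function.iterate_succ_apply', ← ih]
    ext n
    change _ = coeff n (derivative R _)
    rw [coeff_coeffX, coeff_dt, coeff_derivative, coeff_coeffX]
    have h : ((n : LaurentPolynomial R) + 1) = LaurentPolynomial.C ((n : R) + 1) := by simp
    rw [h, mul_comm, ← LaurentPolynomial.smul_eq_C_mul, AddMonoidAlgebra.coeff_smul,
      Finsupp.smul_apply, smul_eq_mul, mul_comm]

theorem coeffX_dx (e : ℤ) (f : LSeries2 R) :
    coeffX e (dx f) = ((e : R) + 1) • coeffX (e + 1) f := by
  ext n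
  rw [coeff_coeffX, coeff_dx, coeff_laurentDerivLin, PowerSeries.coeff_smul, coeff_coeffX,
    smul_eq_mul]

theorem coeffX_dx_iterate_of_lt {m k : ℕ} (h : m < k) (f : LSeries2 R) :
    coeffX (-1 - m) (dx^[k] f) = 0 := by
  induction k generalizing m with
  | zero => omega
  | succ k ih =>
    rw [Function.iterate_succ_apply', coeffX_dx]
    rcases m with _ | m
    · simp
    · rw [show (-1 - ((m + 1 : ℕ) : ℤ) + 1) = -1 - m by push_cast; ring, ih (by omega), smul_zero]

theorem coeffX_dx_iterate_self (m : ℕ) (f : LSeries2 R) :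
    coeffX (-1 - m) (dx^[m] f) = ((-1 : R) ^ m * (m.factorial : R)) • coeffX (-1) f := by
  induction m with
  | zero => simp
  | succ m ih =>
    rw [Function.iterate_succ_apply', coeffX_dx,
      show (-1 - ((m + 1 : ℕ) : ℤ) + 1) = -1 - m by push_cast; ring, ih, smul_smul]
    congr 1
    rw [Nat.factorial_succ]
    push_cast
    ring

theorem derivativeFun_iterate_smul (r : R) (f : PowerSeries R) (j : ℕ) :
    derivativeFun^[j] (r • f) = r • derivativeFun^[j] f := by
  induction j with
  | zero => rfl
  | succ j ih =>
    rw [Function.iterate_succ_apply', ih, derivativeFun_smul, Function.iterate_succ_apply']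

theorem coe_monomial_mul (i : ℕ) (r : R) (f : PowerSeries R) :
    ((Polynomial.monomial i r : Polynomial R) : PowerSeries R) * f = r • (X ^ i * f) := by
  rw [← Polynomial.C_mul_X_pow_eq_monomial, Polynomial.coe_mul, Polynomial.coe_C,
    Polynomial.coe_pow, Polynomial.coe_X, mul_assoc, PowerSeries.smul_eq_C_mul]

theorem isDFinite_of_relation [IsDomain R] [CharZero R] {f : LSeries2 R} {N : ℕ}
    {c : Fin N × Fin N × Fin N → R} (hc : ∃ q, c q ≠ 0)
    (h : ∑ q, c q • (X ^ (q.1 : ℕ) * dt^[(q.2.1 : ℕ)] (dx^[(q.2.2 : ℕ)] f)) = 0) :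
    IsDFinite (coeffX (-1) f) := by
  classical
  have hex : ∃ m : ℕ, ∃ q, (q.2.2 : ℕ) = m ∧ c q ≠ 0 := let ⟨q, hq⟩ := hc; ⟨_, q, rfl, hq⟩
  obtain ⟨q₀, hq₀, hcq₀⟩ := Nat.find_spec hex
  have hmin : ∀ q, (q.2.2 : ℕ) < Nat.find hex → c q = 0 := fun q hq => by
    by_contra hne
    exact Nat.find_min hex hq ⟨q, rfl, hne⟩
  set m := Nat.find hex
  obtain ⟨N, rfl⟩ : ∃ N', N = N' + 1 := ⟨N - 1, by have := q₀.1.2; omega⟩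
  have hm : m < N + 1 := hq₀ ▸ q₀.2.2.2
  have hfact : ((-1 : R) ^ m * (m.factorial : R)) ≠ 0 :=
    mul_ne_zero (pow_ne_zero _ (neg_ne_zero.2 one_ne_zero)) (by exact_mod_cast m.factorial_ne_zero)
  refine ⟨N, fun j => ∑ i : Fin (N + 1), Polynomial.monomial (i : ℕ) (c (i, j, ⟨m, hm⟩)), ?_, ?_⟩
  · refine ⟨q₀.2.1, fun h0 => hcq₀ ?_⟩
    have := congrArg (fun p => Polynomial.coeff p (q₀.1 : ℕ)) h0
    simp only [Polynomial.finsetSum_coeff, Polynomial.coeff_monomial, Polynomial.coeff_zero,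
      Fin.val_inj] at this
    rw [Finset.sum_ite_eq' Finset.univ q₀.1] at this
    simp only [Finset.mem_univ, if_true] at this
    rw [← this]
    congr 1
    ext <;> simp [hq₀]
  · have h' := congrArg (coeffX (-1 - m)) h
    rw [map_sum, map_zero, Fintype.sum_prod_type_right] at h'
    rw [Fintype.sum_prod_type_right] at h'
    rw [Finset.sum_eq_single (⟨m, hm⟩ : Fin (N + 1))] at h'
    · have key : ((-1 : R) ^ m * (m.factorial : R)) • (∑ j : Fin (N + 1),
          ((∑ i : Fin (N + 1), Polynomial.monomial (i : ℕ) (c (i, j, ⟨m, hm⟩)) : Polynomial R) :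
            PowerSeries R) * derivativeFun^[(j : ℕ)] (coeffX (-1) f)) = 0 := by
        rw [← h', Finset.smul_sum]
        refine Finset.sum_congr rfl fun j _ => ?_
        rw [← Polynomial.coeToPowerSeries.ringHom_apply, map_sum, Finset.sum_mul, Finset.smul_sum]
        refine Finset.sum_congr rfl fun i _ => ?_
        rw [Polynomial.coeToPowerSeries.ringHom_apply, map_smul, coeffX_X_pow_mul,
          coeffX_dt_iterate, coeffX_dx_iterate_self, derivativeFun_iterate_smul,
          coe_monomial_mul, mul_smul_comm, smul_comm]
      rw [PowerSeries.smul_eq_C_mul] at key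
      exact (mul_eq_zero.1 key).resolve_left fun h0 => hfact (by
        simpa using congrArg (coeff 0) h0)
    · intro k _ hk
      refine Finset.sum_eq_zero fun j _ => Finset.sum_eq_zero fun i _ => ?_
      rw [map_smul]
      rcases lt_or_gt_of_ne (fun h => hk (Fin.ext h) : (k : ℕ) ≠ m) with hlt | hgt
      · rw [hmin _ hlt, zero_smul]
      · rw [coeffX_X_pow_mul, coeffX_dt_iterate, coeffX_dx_iterate_of_lt hgt]
        have h0 := derivativeFun_iterate_smul (0 : R) (0 : PowerSeries R) j
        rw [zero_smul, zero_smul] at h0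
        rw [h0, mul_zero, smul_zero]
    · simp

/-- If `s` and `f` satisfy `P * f ∈ 𝒫 + 𝒫 * s` and `P * δ s ∈ 𝒫 * s` for both derivations, where `𝒫`
is the ring of Laurent polynomials, then the residue in `x` of `f` is D-finite. -/
theorem isDFinite_residue [IsDomain R] [CharZero R] {P s f gx gt p q : LSeries2 R}
    (hP0 : P ≠ 0) (hP : P ∈ polySubring R) (hgx : gx ∈ polySubring R) (hgt : gt ∈ polySubring R)
    (hp : p ∈ polySubring R) (hq : q ∈ polySubring R) (hsx : P * dx s = gx * s)
    (hst : P * dt s = gt * s) (hf : P * f = p + q * s) : IsDFinite (coeffX (-1) f) := by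
  obtain ⟨c₁, h₁⟩ := hP
  obtain ⟨c₂, h₂⟩ := hgx
  obtain ⟨c₃, h₃⟩ := hgt
  obtain ⟨n₁, h₄⟩ := hp
  obtain ⟨n₂, h₅⟩ := hq
  set c := c₁ + c₂ + c₃
  set n := n₁ + n₂
  replace h₁ := boundedPoly_mono (show c₁ ≤ c by omega) h₁
  replace h₂ := boundedPoly_mono (show c₂ ≤ c by omega) h₂
  replace h₃ := boundedPoly_mono (show c₃ ≤ c by omega) h₃
  have hf' : P ^ 1 * f ∈ boundedExt s n := by
    rw [pow_one, hf]
    exact mem_boundedExt.2 ⟨p, boundedPoly_mono (by omega) h₄, q, boundedPoly_mono (by omega) h₅, rfl⟩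
  set b := n + 2 * c + 3 with hb
  set N := 12 * b ^ 2 + 1 with hN
  have hv : ∀ i j k : Fin N, P ^ (1 + N + N) * (X ^ (i : ℕ) * dt^[(j : ℕ)] (dx^[(k : ℕ)] f)) ∈
      boundedExt s (b * N) := by
    intro i j k
    have e₁ := iterate_mem_boundedExt dx dx_mem_boundedPoly h₁ h₂ hsx hf' k
    have e₂ := iterate_mem_boundedExt dt dt_mem_boundedPoly h₁ h₃ hst e₁ j
    have e₃ := mul_mem_boundedExt (pow_mem_boundedPoly h₁ ((N - k) + (N - j))) e₂
    have e₄ := mul_mem_boundedExt (mon_mem (i := 0) (j := i) (n := i) (by simp) (by simp) le_rfl) e₃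
    have hpow : P ^ (1 + N + N) = P ^ ((N - (k : ℕ)) + (N - (j : ℕ))) * P ^ (1 + (k : ℕ) + j) := by
      rw [← pow_add]
      congr 1
      omega
    rw [hpow, show ∀ A B C D : LSeries2 R, A * B * (C * D) = C * (A * (B * D)) by intros; ring,
      ← mon_zero_left]
    refine boundedExt_mono ?_ e₄
    obtain ⟨k', hk'⟩ := Nat.exists_eq_add_of_lt k.2
    obtain ⟨j', hj'⟩ := Nat.exists_eq_add_of_lt j.2
    have hi := i.2
    have hkN : N - k = k' + 1 := by omega
    have hjN : N - j = j' + 1 := by omega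
    rw [hkN, hjN]
    have hnN : n * 1 ≤ n * N := Nat.mul_le_mul_left n (by omega)
    have hck : c * N = c * (k + k' + 1) := by rw [← hk']
    have hcj : c * N = c * (j + j' + 1) := by rw [← hj']
    have hbN : b * N = n * N + c * N + c * N + 3 * N := by rw [hb]; ring
    nlinarith
  have hnot : ¬ LinearIndependent R fun q : Fin N × Fin N × Fin N =>
      X ^ (q.1 : ℕ) * dt^[(q.2.1 : ℕ)] (dx^[(q.2.2 : ℕ)] f) := by
    intro hli
    have hli' := hli.map' (LinearMap.mulLeft R (P ^ (1 + N + N)))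
      (LinearMap.ker_eq_bot.2 (mul_right_injective₀ (pow_ne_zero _ hP0)))
    obtain ⟨W, hW, hcard⟩ := exists_span_boundedExt s (b * N)
    have hle := linearIndependent_le_span' _ hli' (W : Set (LSeries2 R)) (by
      rw [← hW]
      rintro _ ⟨q, rfl⟩
      exact hv q.1 q.2.1 q.2.2)
    simp only [Cardinal.mk_fintype, Fintype.card_prod, Fintype.card_fin, Nat.cast_le,
      Finset.coe_sort_coe, Fintype.card_coe] at hle
    have hbN : 1 ≤ b * N := Nat.mul_pos (by omega) (by omega)
    have hbig : 2 * ((2 * (b * N) + 1) * (b * N + 1)) ≤ 2 * ((3 * (b * N)) * (2 * (b * N))) := by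
      gcongr <;> omega
    have hN2 : 2 * ((3 * (b * N)) * (2 * (b * N))) = (N - 1) * (N * N) := by
      rw [hN, Nat.add_sub_cancel]
      ring
    have hlt : (N - 1) * (N * N) < N * (N * N) :=
      Nat.mul_lt_mul_of_pos_right (by omega) (Nat.mul_pos (by omega) (by omega))
    omega
  obtain ⟨g, hg, hg0⟩ := Fintype.not_linearIndependent_iff.1 hnot
  exact isDFinite_of_relation hg0 hg

theorem exists_eq_of_contracting {A : Type*} [CommRing A] (φ : PowerSeries A → PowerSeries A)
    (hφ : ∀ k g h, X ^ k ∣ g - h → X ^ (k + 1) ∣ φ g - φ h) : ∃ D, D = φ D := by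
  have h₁ : ∀ k, (X : PowerSeries A) ^ k ∣ φ^[k + 1] 0 - φ^[k] 0 := by
    intro k
    induction k with
    | zero => simp
    | succ k ih =>
      rw [Function.iterate_succ_apply', Function.iterate_succ_apply']
      rw [Function.iterate_succ_apply'] at ih
      exact hφ _ _ _ ih
  have h₂ : ∀ k m, k ≤ m → (X : PowerSeries A) ^ k ∣ φ^[m] 0 - φ^[k] 0 := by
    intro k m hkm
    induction m, hkm using Nat.le_induction with
    | base => simp
    | succ m hkm ih =>
      rw [← sub_add_sub_cancel _ (φ^[m] 0)]
      exact dvd_add ((pow_dvd_pow _ hkm).trans (h₁ m)) ih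
  set D : PowerSeries A := PowerSeries.mk fun n => coeff n (φ^[n + 1] 0) with hD
  have h₃ : ∀ k, (X : PowerSeries A) ^ k ∣ D - φ^[k] 0 := by
    intro k
    rw [X_pow_dvd_iff]
    intro m hm
    have := X_pow_dvd_iff.1 (h₂ (m + 1) k hm) m (Nat.lt_succ_self m)
    rw [map_sub, sub_eq_zero] at this
    rw [map_sub, hD, coeff_mk, this, sub_self]
  refine ⟨D, sub_eq_zero.1 (PowerSeries.ext fun n => ?_)⟩
  have h₄ : (X : PowerSeries A) ^ (n + 1) ∣ D - φ D := by
    rw [← sub_sub_sub_cancel_right _ _ (φ^[n + 1] 0)]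
    refine dvd_sub (h₃ _) ?_
    rw [Function.iterate_succ_apply']
    exact hφ _ _ _ (h₃ n)
  exact X_pow_dvd_iff.1 h₄ n (Nat.lt_succ_self n)

/-- Existence of the generating function of Motzkin excursions with weights `u`, `l`, `d` for the
up, level and down steps. -/
theorem exists_excursionSeries {A : Type*} [CommRing A] (u l d : PowerSeries A) :
    ∃ D : PowerSeries A, D = 1 + X * (l * D) + X ^ 2 * (u * d * D ^ 2) := by
  refine exists_eq_of_contracting (fun D => 1 + X * (l * D) + X ^ 2 * (u * d * D ^ 2)) ?_
  rintro k g h ⟨r, hr⟩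
  refine ⟨l * r + X * (u * d * (g + h) * r), ?_⟩
  linear_combination (X * l + X ^ 2 * u * d * (g + h)) * hr

theorem exists_renewalSeries {A : Type*} [CommRing A] (b : PowerSeries A) :
    ∃ H : PowerSeries A, H = 1 + X * (b * H) := by
  refine exists_eq_of_contracting (fun H => 1 + X * (b * H)) ?_
  rintro k g h ⟨r, hr⟩
  refine ⟨b * r, ?_⟩
  linear_combination X * b * hr

theorem coeff_T_mul (n i : ℤ) (f : LaurentPolynomial R) :
    (LaurentPolynomial.T n * f).coeff i = f.coeff (i - n) := by
  induction f using LaurentPolynomial.induction_on' with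
  | add p q hp hq => simp [mul_add, hp, hq, -LaurentPolynomial.T_mul]
  | C_mul_T m a =>
    rw [← LaurentPolynomial.single_eq_C_mul_T, LaurentPolynomial.T,
      AddMonoidAlgebra.single_mul_single, one_mul, AddMonoidAlgebra.coeff_single,
      AddMonoidAlgebra.coeff_single, Finsupp.single_apply, Finsupp.single_apply]
    congr 1
    exact propext ⟨fun h => by omega, fun h => by omega⟩

theorem coeff_C_mul' (r : R) (i : ℤ) (f : LaurentPolynomial R) :
    (LaurentPolynomial.C r * f).coeff i = r * f.coeff i := by
  rw [← LaurentPolynomial.smul_eq_C_mul, AddMonoidAlgebra.coeff_smul, Finsupp.smul_apply,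
    smul_eq_mul]

/-- The step polynomial `α + β * (x + x⁻¹)`. -/
noncomputable def stepPoly (α β : R) : LaurentPolynomial R :=
  LaurentPolynomial.C α + LaurentPolynomial.C β * (LaurentPolynomial.T 1 + LaurentPolynomial.T (-1))

theorem coeff_stepPoly_mul (α β : R) (f : LaurentPolynomial R) (i : ℤ) :
    (stepPoly α β * f).coeff i = α * f.coeff i + β * (f.coeff (i - 1) + f.coeff (i + 1)) := by
  rw [stepPoly, add_mul, mul_assoc, add_mul, AddMonoidAlgebra.coeff_add, Finsupp.add_apply,
    coeff_C_mul', coeff_C_mul', AddMonoidAlgebra.coeff_add, Finsupp.add_apply, coeff_T_mul,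
    coeff_T_mul, sub_neg_eq_add]

theorem C_T_eq_mon (i : ℤ) : (PowerSeries.C (LaurentPolynomial.T i) : LSeries2 R) = mon i 0 := by
  simp [mon]

theorem C_C_mem_polySubring (r : R) :
    (PowerSeries.C (LaurentPolynomial.C r) : LSeries2 R) ∈ polySubring R := by
  have : (PowerSeries.C (LaurentPolynomial.C r) : LSeries2 R) = r • 1 := by
    ext1 n
    rw [PowerSeries.coeff_smul, coeff_C, coeff_one]
    split_ifs <;> simp [LaurentPolynomial.smul_eq_C_mul]
  rw [this]
  exact smul_mem_polySubring r (one_mem _)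

theorem C_stepPoly_mem_polySubring (α β : R) :
    (PowerSeries.C (stepPoly α β) : LSeries2 R) ∈ polySubring R := by
  rw [stepPoly, map_add, map_mul, map_add, C_T_eq_mon, C_T_eq_mon]
  exact add_mem (C_C_mem_polySubring _) (mul_mem (C_C_mem_polySubring _)
    (add_mem (mon_mem_polySubring _ _) (mon_mem_polySubring _ _)))

theorem X_mem_polySubring : (X : LSeries2 R) ∈ polySubring R := by
  rw [← pow_one X, ← mon_zero_left]
  exact mon_mem_polySubring _ _

theorem isDFinite_of_excursions [IsDomain R] [CharZero R] {a : R} (ha : a ≠ 1)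
    {u l d D H : LSeries2 R} (hu : u ∈ polySubring R) (hl : l ∈ polySubring R)
    (hd : d ∈ polySubring R) (hD : D = 1 + X * (l * D) + X ^ 2 * (u * d * D ^ 2))
    (hH : H = 1 + X * (PowerSeries.C (LaurentPolynomial.C a) * (l + X * (u * d * D)) * H)) :
    IsDFinite (coeffX (-1) ((mon (-1) 0 - mon 1 0) * H)) := by
  set α : LSeries2 R := PowerSeries.C (LaurentPolynomial.C a) with hα
  set s : LSeries2 R := 1 - X * l - 2 * (X ^ 2 * (u * d * D)) with hs
  set Δ : LSeries2 R := (1 - X * l) ^ 2 - 4 * (X ^ 2 * (u * d)) with hΔ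
  set Q : LSeries2 R := (1 - α) - α * (1 - α) * (X * l) + α ^ 2 * (X ^ 2 * (u * d)) with hQ
  have hαm : α ∈ polySubring R := C_C_mem_polySubring a
  have hXm := X_mem_polySubring (R := R)
  have h2m : (2 : LSeries2 R) ∈ polySubring R := ofNat_mem _ 2
  have h4m : (4 : LSeries2 R) ∈ polySubring R := ofNat_mem _ 4
  have hΔm : Δ ∈ polySubring R := sub_mem (pow_mem (sub_mem (one_mem _) (mul_mem hXm hl)) 2)
    (mul_mem h4m (mul_mem (pow_mem hXm 2) (mul_mem hu hd)))
  have h1αm : 1 - α ∈ polySubring R := sub_mem (one_mem _) hαm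
  have hQm : Q ∈ polySubring R :=
    add_mem (sub_mem h1αm (mul_mem (mul_mem hαm h1αm) (mul_mem hXm hl)))
      (mul_mem (pow_mem hαm 2) (mul_mem (pow_mem hXm 2) (mul_mem hu hd)))
  have hsΔ : s * s = Δ := by
    rw [hs, hΔ]
    linear_combination (-4 * X ^ 2 * u * d) * hD
  have hδ : ∀ δ : Derivation R (LSeries2 R) (LSeries2 R),
      4 * Q * Δ * δ s = 2 * Q * δ Δ * s := by
    intro δ
    rw [← hsΔ, Derivation.leibniz, smul_eq_mul]
    ring
  have hxm : (mon (-1) 0 - mon 1 0 : LSeries2 R) ∈ polySubring R :=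
    sub_mem (mon_mem_polySubring _ _) (mon_mem_polySubring _ _)
  refine isDFinite_residue (P := 4 * Q * Δ) (s := s) (gx := 2 * Q * dx Δ) (gt := 2 * Q * dt Δ)
    (p := Δ * (mon (-1) 0 - mon 1 0) * (2 * (2 - α - α * (X * l))))
    (q := Δ * (mon (-1) 0 - mon 1 0) * (-2 * α)) ?_ ?_ ?_ ?_ ?_ ?_ (hδ dx) (hδ dt) ?_
  · intro h0
    have h1 := congrArg (PowerSeries.constantCoeff) h0
    simp only [hQ, hΔ, hα, map_mul, map_add, map_sub, map_pow, constantCoeff_X, map_one,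
      constantCoeff_C, zero_mul, mul_zero, sub_zero, ne_eq, OfNat.ofNat_ne_zero,
      not_false_eq_true, zero_pow, add_zero, one_pow, mul_one, map_zero, map_ofNat] at h1
    have h4 : (4 : LaurentPolynomial R) = LaurentPolynomial.C 4 := (map_ofNat _ 4).symm
    rw [h4, ← map_one LaurentPolynomial.C, ← map_sub, ← map_mul] at h1
    have h2 := congrArg (fun f => AddMonoidAlgebra.coeff f 0) h1
    simp only [LaurentPolynomial.C_apply, if_true, AddMonoidAlgebra.coeff_zero,
      Finsupp.coe_zero, Pi.zero_apply] at h2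
    rcases mul_eq_zero.1 h2 with h | h
    · exact absurd h (by norm_num)
    · exact ha (sub_eq_zero.1 h).symm
  · exact mul_mem (mul_mem h4m hQm) hΔm
  · exact mul_mem (mul_mem h2m hQm) (dx_mem_polySubring hΔm)
  · exact mul_mem (mul_mem h2m hQm) (dt_mem_polySubring hΔm)
  · exact mul_mem (mul_mem hΔm hxm)
      (mul_mem h2m (sub_mem (sub_mem h2m hαm) (mul_mem hαm (mul_mem hXm hl))))
  · exact mul_mem (mul_mem hΔm hxm) (mul_mem (neg_mem h2m) hαm)
  · have key : 4 * Q * H = 2 * (2 - α - α * (X * l) - α * s) := by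
      have h1 : H * (2 - α - α * (X * l) + α * s) = 2 := by
        rw [hs]
        linear_combination 2 * hH
      have h2 : (2 - α - α * (X * l) + α * s) * (2 - α - α * (X * l) - α * s) = 4 * Q := by
        rw [hΔ] at hsΔ
        rw [hQ]
        linear_combination (-α ^ 2) * hsΔ
      rw [← h2]
      linear_combination (2 - α - α * (X * l) - α * s) * h1
    linear_combination Δ * (mon (-1) 0 - mon 1 0) * key

open Classical in
/-- The points of `ℕ × ℕ` from which `p` can be reached by one step in `S ⊆ {-1, 0, 1}²`. -/
noncomputable def predecessors (S : Set (ℤ × ℤ)) (p : ℕ × ℕ) : Finset (ℕ × ℕ) :=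
  (Finset.range (p.1 + 2) ×ˢ Finset.range (p.2 + 2)).filter fun q =>
    ((p.1 : ℤ) - q.1, (p.2 : ℤ) - q.2) ∈ S

open Classical in
/-- The quarter-plane walks of length `n` from the origin to `p`. -/
noncomputable def walks (S : Set (ℤ × ℤ)) : (n : ℕ) → ℕ × ℕ → Finset (Fin (n + 1) → ℕ × ℕ)
  | 0, p => if p = (0, 0) then {fun _ => (0, 0)} else ∅
  | n + 1, p => (predecessors S p).biUnion fun q =>
      (walks S n q).image fun w => (Fin.snoc w p : Fin (n + 2) → ℕ × ℕ)

theorem mem_predecessors {S : Set (ℤ × ℤ)} (hS : ∀ p ∈ S, -1 ≤ p.1 ∧ -1 ≤ p.2) {p q : ℕ × ℕ} :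
    q ∈ predecessors S p ↔ ((p.1 : ℤ) - q.1, (p.2 : ℤ) - q.2) ∈ S := by
  simp only [predecessors, Finset.mem_filter, Finset.mem_product, Finset.mem_range,
    and_iff_right_iff_imp]
  intro h
  have := hS _ h
  simp only at this
  omega

theorem mem_walks {S : Set (ℤ × ℤ)} (hS : ∀ p ∈ S, -1 ≤ p.1 ∧ -1 ≤ p.2) {n : ℕ} {p : ℕ × ℕ}
    {w : Fin (n + 1) → ℕ × ℕ} :
    w ∈ walks S n p ↔ w 0 = (0, 0) ∧ w (Fin.last n) = p ∧
      ∀ i : Fin n, (((w i.succ).1 : ℤ) - ((w i.castSucc).1 : ℤ),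
        ((w i.succ).2 : ℤ) - ((w i.castSucc).2 : ℤ)) ∈ S := by
  induction n generalizing p with
  | zero =>
    rw [walks]
    constructor
    · intro h
      split_ifs at h with hp
      · rw [Finset.mem_singleton] at h
        subst h hp
        exact ⟨rfl, rfl, fun i => i.elim0⟩
      · simp at h
    · rintro ⟨h₀, h₁, -⟩
      have hp : p = (0, 0) := by rw [← h₁, ← h₀]; rfl
      rw [if_pos hp, Finset.mem_singleton]
      funext i
      rw [@Subsingleton.elim (Fin 1) _ i 0, h₀]
  | succ n ih =>
    rw [walks]
    simp only [Finset.mem_biUnion, Finset.mem_image, mem_predecessors hS]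
    constructor
    · rintro ⟨q, hq, w', hw', rfl⟩
      obtain ⟨h₀, h₁, h₂⟩ := ih.1 hw'
      refine ⟨?_, Fin.snoc_last _ _, fun i => ?_⟩
      · rw [← h₀, ← Fin.castSucc_zero]
        exact Fin.snoc_castSucc (α := fun _ => ℕ × ℕ) p w' 0
      · induction i using Fin.lastCases with
        | last =>
          rw [Fin.succ_last, Fin.snoc_last, Fin.snoc_castSucc (α := fun _ => ℕ × ℕ), h₁]
          exact hq
        | cast i =>
          rw [Fin.succ_castSucc, Fin.snoc_castSucc (α := fun _ => ℕ × ℕ),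
            Fin.snoc_castSucc (α := fun _ => ℕ × ℕ)]
          exact h₂ i
    · rintro ⟨h₀, h₁, h₂⟩
      refine ⟨w (Fin.last n).castSucc, ?_, fun i => w i.castSucc, ?_, ?_⟩
      · have := h₂ (Fin.last n)
        rwa [Fin.succ_last, h₁] at this
      · exact ih.2 ⟨h₀, rfl, fun i => h₂ i.castSucc⟩
      · rw [← h₁]
        exact Fin.snoc_init_self (α := fun _ => ℕ × ℕ) w

theorem hvisits_snoc {n : ℕ} (w : Fin (n + 1) → ℕ × ℕ) (p : ℕ × ℕ) :
    hvisits (Fin.snoc w p : Fin (n + 2) → ℕ × ℕ) = hvisits w + if p.2 = 0 then 1 else 0 := by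
  simp only [hvisits, Finset.card_filter]
  rw [Fin.sum_univ_castSucc]
  congr 1
  · refine Finset.sum_congr rfl fun i _ => ?_
    rw [Fin.snoc_castSucc (α := fun _ => ℕ × ℕ)]
    rfl
  · rw [Fin.snoc_last]
    simp

/-- The weighted number of quarter-plane walks of length `n` from the origin to `p`. -/
noncomputable def walkSum (S : Set (ℤ × ℤ)) (a : R) (n : ℕ) (p : ℕ × ℕ) : R :=
  ∑ w ∈ walks S n p, a ^ hvisits w

theorem coeff_loopGF {S : Set (ℤ × ℤ)} (hS : ∀ p ∈ S, -1 ≤ p.1 ∧ -1 ≤ p.2) (a : R) (n : ℕ) :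
    coeff n (loopGF S a 1) = walkSum S a n (0, 0) := by
  rw [loopGF, coeff_mk, walkSum, ← finsum_mem_coe_finset]
  simp only [one_pow, mul_one]
  rw [finsum_subtype_eq_finsum_cond (f := fun w => a ^ hvisits w)]
  refine finsum_congr fun w => ?_
  have : IsQPLoop S n w ↔ w ∈ (walks S n (0, 0) : Set (Fin (n + 1) → ℕ × ℕ)) := by
    rw [Finset.mem_coe, mem_walks hS]
    rfl
  simp only [this]

theorem walkSum_zero (S : Set (ℤ × ℤ)) (a : R) (p : ℕ × ℕ) :
    walkSum S a 0 p = if p = (0, 0) then 1 else 0 := by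
  rw [walkSum, walks]
  split_ifs with h
  · rw [Finset.sum_singleton, hvisits, Finset.card_eq_zero.2, pow_zero]
    rw [Finset.filter_eq_empty_iff]
    rintro i - ⟨h, -⟩
    omega
  · simp

theorem walkSum_succ {S : Set (ℤ × ℤ)} (hS : ∀ p ∈ S, -1 ≤ p.1 ∧ -1 ≤ p.2) (a : R) (n : ℕ)
    (p : ℕ × ℕ) : walkSum S a (n + 1) p =
      (if p.2 = 0 then a else 1) * ∑ q ∈ predecessors S p, walkSum S a n q := by
  classical
  rw [walkSum, walks, Finset.sum_biUnion, Finset.mul_sum]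
  · refine Finset.sum_congr rfl fun q _ => ?_
    rw [Finset.sum_image, walkSum, Finset.mul_sum]
    · refine Finset.sum_congr rfl fun w _ => ?_
      rw [hvisits_snoc]
      split_ifs
      · rw [pow_succ']
      · rw [add_zero, one_mul]
    · intro w _ w' _ h
      have := congrArg (Fin.init (α := fun _ => ℕ × ℕ)) h
      simpa only [Fin.init_snoc] using this
  · intro q _ q' _ hne
    refine Finset.disjoint_left.2 fun w hw hw' => hne ?_
    obtain ⟨v, hv, rfl⟩ := Finset.mem_image.1 hw
    obtain ⟨v', hv', h⟩ := Finset.mem_image.1 hw'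
    have h₁ := congrArg (Fin.init (α := fun _ => ℕ × ℕ)) h
    simp only [Fin.init_snoc] at h₁
    rw [← ((mem_walks hS).1 hv).2.1, ← ((mem_walks hS).1 hv').2.1, h₁]

open Classical in
/-- The indicator of the step `(i, j)`. -/
noncomputable def stepInd (R : Type*) [CommRing R] (S : Set (ℤ × ℤ)) (i j : ℤ) : R :=
  if (i, j) ∈ S then 1 else 0

/-- Extension by zero of a function on the quarter plane. -/
def extendZero (g : ℕ × ℕ → R) (i j : ℤ) : R :=
  if 0 ≤ i ∧ 0 ≤ j then g (i.toNat, j.toNat) else 0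

theorem sum_neg_one_zero_one {M : Type*} [AddCommMonoid M] (f : ℤ → M) :
    ∑ x ∈ ({-1, 0, 1} : Finset ℤ), f x = f (-1) + f 0 + f 1 := by
  rw [Finset.sum_insert (by decide), Finset.sum_insert (by decide), Finset.sum_singleton,
    add_assoc]

theorem sum_predecessors {S : Set (ℤ × ℤ)}
    (hS : ∀ p ∈ S, (p.1 = -1 ∨ p.1 = 0 ∨ p.1 = 1) ∧ (p.2 = -1 ∨ p.2 = 0 ∨ p.2 = 1))
    (g : ℕ × ℕ → R) (p : ℕ × ℕ) :
    ∑ q ∈ predecessors S p, g q =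
      ∑ j ∈ ({-1, 0, 1} : Finset ℤ), ∑ i ∈ ({-1, 0, 1} : Finset ℤ),
        stepInd R S i j * extendZero g (p.1 - i) (p.2 - j) := by
  classical
  have hS' : ∀ p ∈ S, -1 ≤ p.1 ∧ -1 ≤ p.2 := fun p hp => by have := hS p hp; omega
  rw [← Finset.sum_product']
  refine Finset.sum_bij_ne_zero (fun q _ _ => ((p.2 : ℤ) - q.2, (p.1 : ℤ) - q.1)) ?_ ?_ ?_ ?_
  · intro q hq _
    have := hS _ ((mem_predecessors hS').1 hq)
    simp only [Finset.mem_product, Finset.mem_insert, Finset.mem_singleton]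
    exact ⟨this.2, this.1⟩
  · intro q _ _ q' _ _ h
    rw [Prod.mk.injEq] at h
    ext <;> omega
  · rintro ⟨j, i⟩ _ hne
    have h₁ : (i, j) ∈ S := by
      by_contra h
      exact hne (by rw [stepInd, if_neg h, zero_mul])
    have h₂ : 0 ≤ (p.1 : ℤ) - i ∧ 0 ≤ (p.2 : ℤ) - j := by
      by_contra h
      exact hne (by rw [extendZero, if_neg h, mul_zero])
    rw [stepInd, if_pos h₁, one_mul, extendZero, if_pos h₂] at hne
    refine ⟨(((p.1 : ℤ) - i).toNat, ((p.2 : ℤ) - j).toNat), (mem_predecessors hS').2 ?_, hne, ?_⟩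
    · simp only [Int.toNat_of_nonneg h₂.1, Int.toNat_of_nonneg h₂.2, sub_sub_cancel]
      exact h₁
    · simp only [Int.toNat_of_nonneg h₂.1, Int.toNat_of_nonneg h₂.2, sub_sub_cancel]
  · intro q hq _
    simp only [sub_sub_cancel]
    rw [stepInd, if_pos ((mem_predecessors hS').1 hq), one_mul, extendZero, if_pos (by omega)]
    simp

/-- The step polynomial of the steps with second coordinate `j`. -/
noncomputable def rowPoly (R : Type*) [CommRing R] (S : Set (ℤ × ℤ)) (j : ℤ) :
    LaurentPolynomial R :=
  stepPoly (stepInd R S 0 j) (stepInd R S 1 j)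

theorem stepInd_neg {S : Set (ℤ × ℤ)} (hsym : ∀ p ∈ S, (-p.1, p.2) ∈ S) (i j : ℤ) :
    stepInd R S (-i) j = stepInd R S i j := by
  have : (-i, j) ∈ S ↔ (i, j) ∈ S := ⟨fun h => by simpa using hsym _ h, fun h => hsym _ h⟩
  by_cases h : (i, j) ∈ S
  · rw [stepInd, stepInd, if_pos h, if_pos (this.2 h)]
  · rw [stepInd, stepInd, if_neg h, if_neg (mt this.1 h)]

/-- The reflection principle, in one row. -/
theorem sum_stepInd_mul_extendZero {S : Set (ℤ × ℤ)} (hsym : ∀ p ∈ S, (-p.1, p.2) ∈ S)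
    {g : ℕ × ℕ → R} {f : LaurentPolynomial R} {j : ℕ} (hf : ∀ i, f.coeff (-i) = f.coeff i)
    (hg : ∀ i : ℕ, g (i, j) = f.coeff i - f.coeff (i + 2)) (i : ℕ) (k : ℤ) :
    ∑ e ∈ ({-1, 0, 1} : Finset ℤ), stepInd R S e k * extendZero g (i - e) j =
      (rowPoly R S k * f).coeff i - (rowPoly R S k * f).coeff (i + 2) := by
  have hext : ∀ e : ℤ, -1 ≤ e → extendZero g e j = f.coeff e - f.coeff (e + 2) := by
    intro e he
    rcases he.eq_or_lt with rfl | he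
    · rw [extendZero, if_neg (by omega), hf 1, show (-1 + 2 : ℤ) = 1 by norm_num, sub_self]
    · obtain ⟨m, rfl⟩ := Int.eq_ofNat_of_zero_le (show 0 ≤ e by omega)
      rw [extendZero, if_pos (by omega), Int.toNat_natCast, Int.toNat_natCast, hg]
  rw [sum_neg_one_zero_one,
    hext _ (by omega), hext _ (by omega), hext _ (by omega), stepInd_neg hsym, rowPoly,
    coeff_stepPoly_mul, coeff_stepPoly_mul]
  rw [show (i : ℤ) - -1 = i + 1 by ring, show (i : ℤ) - 0 = i by ring,
    show (i : ℤ) - 1 + 2 = i + 1 by ring, show (i : ℤ) + 1 + 2 = i + 3 by ring,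
    show (i : ℤ) + 2 - 1 = i + 1 by ring, show (i : ℤ) + 2 + 1 = i + 3 by ring]
  ring

theorem coeff_neg_stepPoly_mul (α β : R) {f : LaurentPolynomial R}
    (hf : ∀ i, f.coeff (-i) = f.coeff i) (i : ℤ) :
    (stepPoly α β * f).coeff (-i) = (stepPoly α β * f).coeff i := by
  rw [coeff_stepPoly_mul, coeff_stepPoly_mul, hf, show -i - 1 = -(i + 1) by ring,
    show -i + 1 = -(i - 1) by ring, hf, hf]
  ring

theorem walkSum_eq {S : Set (ℤ × ℤ)}
    (hS : ∀ p ∈ S, (p.1 = -1 ∨ p.1 = 0 ∨ p.1 = 1) ∧ (p.2 = -1 ∨ p.2 = 0 ∨ p.2 = 1))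
    (hsym : ∀ p ∈ S, (-p.1, p.2) ∈ S) (a : R) {h : ℕ → ℕ → LaurentPolynomial R}
    (h_init : ∀ j, h 0 j = if j = 0 then 1 else 0)
    (h_zero : ∀ n, h (n + 1) 0 = LaurentPolynomial.C a *
      (rowPoly R S 0 * h n 0 + rowPoly R S (-1) * h n 1))
    (h_succ : ∀ n j, h (n + 1) (j + 1) =
      rowPoly R S 1 * h n j + rowPoly R S 0 * h n (j + 1) + rowPoly R S (-1) * h n (j + 2))
    (n j : ℕ) : (∀ i, (h n j).coeff (-i) = (h n j).coeff i) ∧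
      ∀ i : ℕ, walkSum S a n (i, j) = (h n j).coeff i - (h n j).coeff (i + 2) := by
  have hS' : ∀ p ∈ S, -1 ≤ p.1 ∧ -1 ≤ p.2 := fun p hp => by have := hS p hp; omega
  induction n generalizing j with
  | zero =>
    rw [h_init]
    split_ifs with hj
    · subst hj
      rw [← map_one LaurentPolynomial.C]
      refine ⟨fun i => by rw [LaurentPolynomial.C_apply, LaurentPolynomial.C_apply]; simp, fun i => ?_⟩
      rw [walkSum_zero, LaurentPolynomial.C_apply, LaurentPolynomial.C_apply,
        if_neg (show (i : ℤ) + 2 ≠ 0 by omega), sub_zero]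
      simp
    · refine ⟨fun i => by simp, fun i => ?_⟩
      rw [walkSum_zero, if_neg (by simp [hj])]
      simp
  | succ n ih =>
    have hrow : ∀ (j : ℕ) (k : ℤ) (i : ℕ), ∑ e ∈ ({-1, 0, 1} : Finset ℤ),
        stepInd R S e k * extendZero (walkSum S a n) (i - e) j =
          (rowPoly R S k * h n j).coeff i - (rowPoly R S k * h n j).coeff (i + 2) :=
      fun j k i => sum_stepInd_mul_extendZero hsym (ih j).1 (ih j).2 i k
    have hneg : ∀ (j : ℕ) (k : ℤ) (i : ℤ),
        (rowPoly R S k * h n j).coeff (-i) = (rowPoly R S k * h n j).coeff i :=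
      fun j k i => coeff_neg_stepPoly_mul _ _ (ih j).1 i
    rcases j with _ | j
    · rw [h_zero]
      refine ⟨fun i => ?_, fun i => ?_⟩
      · rw [coeff_C_mul', coeff_C_mul', AddMonoidAlgebra.coeff_add, Finsupp.add_apply,
          Finsupp.add_apply, hneg, hneg]
      · have hout : ∀ e : ℤ, extendZero (walkSum S a n) e (((0 : ℕ) : ℤ) - 1) = 0 := fun e => by
          rw [extendZero, if_neg (by omega)]
        rw [walkSum_succ hS', sum_predecessors hS, sum_neg_one_zero_one fun j => ∑ i ∈ _, _]
        simp only [hout, mul_zero, Finset.sum_const_zero, if_true]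
        rw [show ((0 : ℕ) : ℤ) - -1 = (1 : ℕ) by simp, show ((0 : ℕ) : ℤ) - 0 = (0 : ℕ) by simp,
          hrow, hrow, coeff_C_mul', coeff_C_mul', AddMonoidAlgebra.coeff_add, Finsupp.add_apply,
          Finsupp.add_apply]
        ring
    · rw [h_succ]
      refine ⟨fun i => ?_, fun i => ?_⟩
      · simp only [AddMonoidAlgebra.coeff_add, Finsupp.add_apply, hneg]
      · rw [walkSum_succ hS', sum_predecessors hS, sum_neg_one_zero_one fun j => ∑ i ∈ _, _,
          if_neg (by simp), one_mul]
        dsimp only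
        rw [show ((j + 1 : ℕ) : ℤ) - -1 = (j + 2 : ℕ) by push_cast; ring,
          show ((j + 1 : ℕ) : ℤ) - 0 = (j + 1 : ℕ) by push_cast; ring,
          show ((j + 1 : ℕ) : ℤ) - 1 = (j : ℕ) by push_cast; ring, hrow, hrow, hrow]
        simp only [AddMonoidAlgebra.coeff_add, Finsupp.add_apply]
        ring

theorem isDFinite_loopGF [IsDomain R] [CharZero R] {S : Set (ℤ × ℤ)}
    (hS : ∀ p ∈ S, (p.1 = -1 ∨ p.1 = 0 ∨ p.1 = 1) ∧ (p.2 = -1 ∨ p.2 = 0 ∨ p.2 = 1))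
    (hsym : ∀ p ∈ S, (-p.1, p.2) ∈ S) {a : R} (ha : a ≠ 1) : IsDFinite (loopGF S a 1) := by
  have hS' : ∀ p ∈ S, -1 ≤ p.1 ∧ -1 ≤ p.2 := fun p hp => by have := hS p hp; omega
  set u : LSeries2 R := PowerSeries.C (rowPoly R S 1) with hu
  set l : LSeries2 R := PowerSeries.C (rowPoly R S 0) with hl
  set d : LSeries2 R := PowerSeries.C (rowPoly R S (-1)) with hd
  obtain ⟨D, hD⟩ := exists_excursionSeries u l d
  obtain ⟨H, hH⟩ := exists_renewalSeries
    (PowerSeries.C (LaurentPolynomial.C a) * (l + X * (u * d * D)))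
  set G : ℕ → LSeries2 R := fun j => (X * (u * D)) ^ j * H with hG
  have hG0 : G 0 = 1 + X * (PowerSeries.C (LaurentPolynomial.C a) * (l * G 0 + d * G 1)) := by
    simp only [hG]
    linear_combination hH
  have hGs : ∀ j, G (j + 1) = X * (u * G j + l * G (j + 1) + d * G (j + 2)) := by
    intro j
    simp only [hG]
    linear_combination X * u * (X * (u * D)) ^ j * H * hD
  have key := walkSum_eq hS hsym a (h := fun n j => coeff n (G j)) ?_ ?_ ?_
  · have hres : loopGF S a 1 = coeffX (-1) ((mon (-1) 0 - mon 1 0) * H) := by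
      ext n
      have hk := key n 0
      have hC : (mon (-1) 0 - mon 1 0 : LSeries2 R) =
          PowerSeries.C (LaurentPolynomial.T (-1) - LaurentPolynomial.T 1) := by
        rw [map_sub, C_T_eq_mon, C_T_eq_mon]
      have hGH : G 0 = H := by simp [hG]
      rw [hGH] at hk
      rw [coeff_loopGF hS', hk.2 0, coeff_coeffX, hC,
        coeff_C_mul, sub_mul, AddMonoidAlgebra.coeff_sub, Finsupp.sub_apply, coeff_T_mul,
        coeff_T_mul]
      have := hk.1 2
      norm_num
      exact this.symm
    rw [hres]
    exact isDFinite_of_excursions ha (C_stepPoly_mem_polySubring _ _)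
      (C_stepPoly_mem_polySubring _ _) (C_stepPoly_mem_polySubring _ _) hD hH
  · intro j
    rcases j with _ | j
    · rw [hG0]
      simp
    · rw [hGs]
      simp
  · intro n
    rw [hG0, map_add, coeff_succ_X_mul, coeff_C_mul, map_add, hl, hd, coeff_C_mul, coeff_C_mul,
      coeff_one, if_neg (Nat.succ_ne_zero n), zero_add, ← hG0]
  · intro n j
    rw [hGs, coeff_succ_X_mul, map_add, map_add, hu, hl, hd, coeff_C_mul, coeff_C_mul, coeff_C_mul,
      ← hGs]

end QuarterPlane

/-- For any step set `S ⊆ {−1,0,1}²∖{(0,0)}` invariant under the horizontal reflection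
`(i,j) ↦ (−i,j)`, the generating function `G_S(t;a,1)` is D-finite. -/
theorem symmetric_models_Ga1_dfinite (S : Set (ℤ × ℤ))
    (hS : ∀ p ∈ S, (p.1 = -1 ∨ p.1 = 0 ∨ p.1 = 1) ∧ (p.2 = -1 ∨ p.2 = 0 ∨ p.2 = 1)
      ∧ p ≠ (0, 0))
    (hsym : ∀ p ∈ S, (-p.1, p.2) ∈ S) :
    IsDFinite (loopGF S (Polynomial.X : Polynomial ℚ) 1) :=
  QuarterPlane.isDFinite_loopGF (fun p hp => ⟨(hS p hp).1, (hS p hp).2.1⟩) hsym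
    fun h => by simpa using congrArg (Polynomial.eval 0) h
end

section
/- Let S = {(0,1),(−1,0),(1,−1)} (Model 17). Then the interacting generating function G_S(t;1,b) ∈ ℚ[b][[t]], counting loops by length and visits to the vertical boundary only, is D-finite. -/
open PowerSeries

/-- The possible successors of a point of the quarter plane under the steps of Model 17. -/
def successors (p : ℕ × ℕ) : Finset (ℕ × ℕ) :=
  {q ∈ {(p.1, p.2 + 1), (p.1 - 1, p.2), (p.1 + 1, p.2 - 1)} |
    ((q.1 : ℤ) - p.1, (q.2 : ℤ) - p.2) ∈ ({(0, 1), (-1, 0), (1, -1)} : Set (ℤ × ℤ))}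

lemma mem_successors {p q : ℕ × ℕ} :
    q ∈ successors p ↔
      ((q.1 : ℤ) - p.1, (q.2 : ℤ) - p.2) ∈ ({(0, 1), (-1, 0), (1, -1)} : Set (ℤ × ℤ)) := by
  obtain ⟨a, b⟩ := p
  obtain ⟨c, d⟩ := q
  simp only [successors, Finset.mem_filter, Finset.mem_insert, Finset.mem_singleton,
    Set.mem_insert_iff, Set.mem_singleton_iff, Prod.mk.injEq]
  omega

/-- Model 17 walks of length `n` in the quarter plane from `p` to the origin. -/
def walksToOrigin : (n : ℕ) → ℕ × ℕ → Finset (Fin (n + 1) → ℕ × ℕ)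
  | 0, p => if p = (0, 0) then {fun _ => p} else ∅
  | n + 1, p => (successors p).biUnion fun q =>
      (walksToOrigin n q).image fun w => (Fin.cons p w : Fin (n + 2) → ℕ × ℕ)

lemma mem_walksToOrigin {n : ℕ} {p : ℕ × ℕ} {w : Fin (n + 1) → ℕ × ℕ} :
    w ∈ walksToOrigin n p ↔ w 0 = p ∧ w (Fin.last n) = (0, 0) ∧
      ∀ i : Fin n, (((w i.succ).1 : ℤ) - ((w i.castSucc).1 : ℤ),
        ((w i.succ).2 : ℤ) - ((w i.castSucc).2 : ℤ)) ∈
          ({(0, 1), (-1, 0), (1, -1)} : Set (ℤ × ℤ)) := by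
  induction n generalizing p with
  | zero =>
    have key : w = (fun _ => p) ↔ w 0 = p :=
      ⟨fun h => by rw [h], fun h => funext fun i => by rw [Fin.fin_one_eq_zero i, h]⟩
    have last_eq : w (Fin.last 0) = w 0 := rfl
    rw [walksToOrigin]
    split_ifs with hp
    · subst hp
      simp only [Finset.mem_singleton, key, last_eq]
      simp
    · simp only [Finset.notMem_empty, last_eq, false_iff]
      rintro ⟨h, h', -⟩
      exact hp (h ▸ h')
  | succ n ih =>
    simp only [walksToOrigin, Finset.mem_biUnion, Finset.mem_image]
    constructor
    · rintro ⟨q, hq, v, hv, rfl⟩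
      obtain ⟨h0, hl, hs⟩ := ih.1 hv
      refine ⟨rfl, by rw [← Fin.succ_last, Fin.cons_succ, hl], Fin.cases ?_ fun i => ?_⟩
      · rw [Fin.castSucc_zero, Fin.cons_zero, Fin.cons_succ, h0]
        exact mem_successors.1 hq
      · rw [← Fin.succ_castSucc, Fin.cons_succ, Fin.cons_succ]
        exact hs i
    · rintro ⟨rfl, hl, hs⟩
      refine ⟨w 1, mem_successors.2 (hs 0), Fin.tail w, ih.2 ⟨rfl, hl, fun i => hs i.succ⟩,
        Fin.cons_self_tail w⟩

/-- The number of points of `w`, the starting point included, on the vertical boundary. -/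
def boundaryPoints {n : ℕ} (w : Fin (n + 1) → ℕ × ℕ) : ℕ :=
  (Finset.univ.filter fun i : Fin (n + 1) => (w i).1 = 0).card

/-- The enumerator of the walks of length `n` from `p` to the origin by `boundaryPoints`. -/
noncomputable def walkPoly (n : ℕ) (p : ℕ × ℕ) : Polynomial ℚ :=
  ∑ w ∈ walksToOrigin n p, Polynomial.X ^ boundaryPoints w

lemma walkPoly_zero (p : ℕ × ℕ) :
    walkPoly 0 p = if p = (0, 0) then Polynomial.X else 0 := by
  unfold walkPoly walksToOrigin
  split_ifs with hp
  · simp [boundaryPoints, hp]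
  · simp

lemma walkPoly_succ (n : ℕ) (p : ℕ × ℕ) :
    walkPoly (n + 1) p =
      (if p.1 = 0 then Polynomial.X else 1) * ∑ q ∈ successors p, walkPoly n q := by
  unfold walkPoly
  rw [walksToOrigin, Finset.sum_biUnion, Finset.mul_sum]
  · refine Finset.sum_congr rfl fun q _ => ?_
    rw [Finset.sum_image fun v _ w _ h => Fin.cons_right_injective (α := fun _ => ℕ × ℕ) p h,
      Finset.mul_sum]
    refine Finset.sum_congr rfl fun w _ => ?_
    rw [boundaryPoints, Fin.card_filter_univ_succ]
    simp only [Fin.cons_zero, Fin.cons_succ, boundaryPoints]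
    split_ifs
    · rw [pow_succ']
    · rw [one_mul]
  · intro q _ q' _ hne
    refine Finset.disjoint_left.2 fun w hw hw' => hne ?_
    obtain ⟨v, hv, rfl⟩ := Finset.mem_image.1 hw
    obtain ⟨v', hv', h⟩ := Finset.mem_image.1 hw'
    rw [← (mem_walksToOrigin.1 hv).1, ← (mem_walksToOrigin.1 hv').1,
      Fin.cons_right_injective (α := fun _ => ℕ × ℕ) p h]

lemma sum_successors {M : Type*} [AddCommMonoid M] (g : ℕ × ℕ → M) (x y : ℕ) :
    ∑ q ∈ successors (x, y), g q =
      g (x, y + 1) + (if x = 0 then 0 else g (x - 1, y)) +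
        if y = 0 then 0 else g (x + 1, y - 1) := by
  have h : successors (x, y) = insert (x, y + 1)
      ((if x = 0 then ∅ else {(x - 1, y)}) ∪ if y = 0 then ∅ else {(x + 1, y - 1)}) := by
    ext ⟨a, b⟩
    rw [mem_successors]
    split_ifs <;> simp <;> omega
  rw [h, Finset.sum_insert, Finset.sum_union, add_assoc]
  · split_ifs <;> simp
  · split_ifs <;> simp
  · split_ifs <;> simp

lemma X_mul_coeff_loopGF (n : ℕ) :
    Polynomial.X * coeff n (loopGF ({((0:ℤ), (1:ℤ)), (-1, 0), (1, -1)} : Set (ℤ × ℤ))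
      (1 : Polynomial ℚ) Polynomial.X) = walkPoly n (0, 0) := by
  have mem (w : Fin (n + 1) → ℕ × ℕ) :
      IsQPLoop {(0, 1), (-1, 0), (1, -1)} n w ↔ w ∈ walksToOrigin n (0, 0) :=
    mem_walksToOrigin.symm
  rw [loopGF, coeff_mk,
    finsum_subtype_eq_finsum_cond (f := fun w : Fin (n + 1) → ℕ × ℕ =>
      (1 : Polynomial ℚ) ^ hvisits w * Polynomial.X ^ vvisits w)]
  simp_rw [mem]
  rw [finsum_mem_finset_eq_sum, walkPoly, Finset.mul_sum]
  refine Finset.sum_congr rfl fun w hw => ?_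
  have h0 := (mem_walksToOrigin.1 hw).1
  rw [one_pow, one_mul, ← pow_succ', vvisits, boundaryPoints, Fin.card_filter_univ_succ,
    Fin.card_filter_univ_succ]
  simp [h0]

/-- The number of standard Young tableaux of shape `(u, s, a)`, by the hook length formula; it
vanishes for `a = s + 1` and for `s = u + 1`. -/
def tableauCount (a s u : ℕ) : ℚ :=
  (a + s + u).factorial * ((s + 1 - a) * (u + 2 - a) * (u + 1 - s)) /
    (a.factorial * (s + 1).factorial * (u + 2).factorial)

lemma tableauCount_branching {a s u : ℕ} (has : a ≤ s) (hsu : s ≤ u) (h : a + s + u ≠ 0) :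
    tableauCount a s u =
      (if a = 0 then 0 else tableauCount (a - 1) s u) +
        (if s = 0 then 0 else tableauCount a (s - 1) u) +
        if u = 0 then 0 else tableauCount a s (u - 1) := by
  obtain ⟨N, hN⟩ := Nat.exists_eq_succ_of_ne_zero h
  have ha : (if a = 0 then 0 else tableauCount (a - 1) s u) =
      N.factorial * (a * (s + 2 - a) * (u + 3 - a) * (u + 1 - s)) /
        (a.factorial * (s + 1).factorial * (u + 2).factorial) := by
    rcases a with _ | a
    · simp
    · rw [if_neg a.succ_ne_zero, Nat.add_sub_cancel, tableauCount,
        show a + s + u = N by omega, Nat.factorial_succ a]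
      push_cast
      field_simp
      ring
  have hs : (if s = 0 then 0 else tableauCount a (s - 1) u) =
      N.factorial * ((s + 1) * (s - a) * (u + 2 - a) * (u + 2 - s)) /
        (a.factorial * (s + 1).factorial * (u + 2).factorial) := by
    rcases s with _ | s
    · simp [Nat.le_zero.1 has]
    · rw [if_neg s.succ_ne_zero, Nat.add_sub_cancel, tableauCount,
        show a + s + u = N by omega, Nat.factorial_succ (s + 1)]
      push_cast
      field_simp
      ring
  have hu : (if u = 0 then 0 else tableauCount a s (u - 1)) =
      N.factorial * ((u + 2) * (s + 1 - a) * (u + 1 - a) * (u - s)) /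
        (a.factorial * (s + 1).factorial * (u + 2).factorial) := by
    rcases u with _ | u
    · simp [Nat.le_zero.1 hsu]
    · rw [if_neg u.succ_ne_zero, Nat.add_sub_cancel, tableauCount,
        show a + s + u = N by omega, Nat.factorial_succ (u + 2)]
      push_cast
      field_simp
      ring
  have hNq : (a + s + u : ℚ) = N + 1 := by exact_mod_cast hN
  rw [ha, hs, hu, tableauCount, hN, Nat.factorial_succ, Nat.cast_mul, Nat.cast_succ, ← hNq]
  field_simp
  ring

lemma tableauCount_succ_left (s u : ℕ) : tableauCount (s + 1) s u = 0 := by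
  simp [tableauCount]

lemma tableauCount_succ_middle (a u : ℕ) : tableauCount a (u + 1) u = 0 := by
  simp [tableauCount]

/-- The generating function of the tableau counts of the shapes `(u + m, s, a)`. -/
def tableauSeries (a s u : ℕ) : PowerSeries ℚ :=
  PowerSeries.mk fun m => tableauCount a s (u + m)

lemma tableauSeries_branching {a s u : ℕ} (has : a ≤ s) (hsu : s < u) :
    tableauSeries a s u =
      (if a = 0 then 0 else tableauSeries (a - 1) s u) + tableauSeries a s (u - 1) +
        if s = a then 0 else tableauSeries a (s - 1) u := by
  ext m
  have h := tableauCount_branching has (show s ≤ u + m by omega) (by omega)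
  rw [if_neg (show u + m ≠ 0 by omega), show u + m - 1 = u - 1 + m by omega] at h
  have hs : (if s = 0 then 0 else tableauCount a (s - 1) (u + m)) =
      if s = a then 0 else tableauCount a (s - 1) (u + m) := by
    rcases s with _ | s
    · simp [Nat.le_zero.1 has]
    · rw [if_neg s.succ_ne_zero]
      split_ifs with hsa
      · rw [← hsa, Nat.add_sub_cancel, tableauCount_succ_left]
      · rfl
  rw [hs] at h
  split_ifs at h ⊢ <;> simp only [tableauSeries, map_add, map_zero, coeff_mk, h] <;> ring

lemma one_sub_X_mul_tableauSeries {a s : ℕ} (has : a ≤ s) (h0 : s ≠ 0) :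
    (1 - PowerSeries.X) * tableauSeries a s s =
      (if a = 0 then 0 else tableauSeries (a - 1) s s) +
        if s = a then 0 else tableauSeries a (s - 1) s := by
  ext m
  have h := tableauCount_branching has (show s ≤ s + m by omega) (by omega)
  obtain ⟨s, rfl⟩ := Nat.exists_eq_succ_of_ne_zero h0
  have hs : tableauCount a s (s + 1 + m) =
      if s + 1 = a then 0 else tableauCount a s (s + 1 + m) := by
    split_ifs with hsa
    · rw [← hsa, tableauCount_succ_left]
    · rfl
  have hu : tableauCount a (s + 1) (s + 1 + m - 1) =
      coeff m (PowerSeries.X * tableauSeries a (s + 1) (s + 1)) := by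
    rcases m with _ | m
    · rw [coeff_zero_X_mul, Nat.add_zero, Nat.add_sub_cancel, tableauCount_succ_middle]
    · rw [coeff_succ_X_mul, tableauSeries, coeff_mk]
      rfl
  simp only [Nat.succ_eq_add_one, Nat.add_sub_cancel, if_neg s.succ_ne_zero,
    if_neg (show s + 1 + m ≠ 0 by omega)] at h ⊢
  rw [hs, hu] at h
  rw [sub_mul, one_mul, map_sub, sub_eq_iff_eq_add]
  conv_lhs => rw [tableauSeries, coeff_mk, h]
  split_ifs <;> simp only [tableauSeries, map_add, map_zero, coeff_mk]

/-- The substitution `b = 1 / (1 - c)`, where `c` is the variable of the power series. -/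
noncomputable def geomSubst : Polynomial ℚ →ₐ[ℚ] PowerSeries ℚ :=
  Polynomial.aeval (PowerSeries.mk 1)

lemma geomSubst_X_mul_one_sub : geomSubst Polynomial.X * (1 - PowerSeries.X) = 1 := by
  rw [geomSubst, Polynomial.aeval_X, PowerSeries.mk_one_mul_one_sub_eq_one]

lemma geomSubst_injective : Function.Injective geomSubst := by
  refine (injective_iff_map_eq_zero geomSubst).2 fun P hP => ?_
  have hB : (1 - PowerSeries.X : PowerSeries ℚ) * geomSubst Polynomial.X = 1 := by
    rw [mul_comm, geomSubst_X_mul_one_sub]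
  let _ : Invertible (geomSubst Polynomial.X) := ⟨_, hB, geomSubst_X_mul_one_sub⟩
  have h := Polynomial.eval₂_reverse_mul_pow (algebraMap ℚ (PowerSeries ℚ))
    (geomSubst Polynomial.X) P
  have hP' : Polynomial.eval₂ (algebraMap ℚ (PowerSeries ℚ)) (geomSubst Polynomial.X) P = 0 := by
    rw [← hP, geomSubst, Polynomial.aeval_X]
    rfl
  rw [hP'] at h
  have h2 := (mul_eq_zero.1 h).resolve_right
    (pow_ne_zero _ (left_ne_zero_of_mul_eq_one geomSubst_X_mul_one_sub))
  have h3 : ((P.reverse.comp (1 - Polynomial.X) : Polynomial ℚ) : PowerSeries ℚ) = 0 := by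
    rw [← h2, ← Polynomial.coeToPowerSeries.ringHom_apply, Polynomial.comp, Polynomial.hom_eval₂,
      map_sub, map_one, Polynomial.coeToPowerSeries.ringHom_apply, Polynomial.coe_X]
    congr 1
    ext r : 1
    simp
  have h4 : (P.reverse.comp (1 - Polynomial.X)).comp (1 - Polynomial.X) = 0 := by
    rw [Polynomial.coe_eq_zero_iff.1 h3, Polynomial.zero_comp]
  rw [Polynomial.comp_assoc] at h4
  simpa using h4

lemma geomSubst_walkPoly (n : ℕ) :
    (∀ r x y, n = 3 * r + 2 * y + x →
      geomSubst (walkPoly n (x, y)) = tableauSeries r (r + y) (r + y + x)) ∧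
    ∀ x y, (∀ r, n ≠ 3 * r + 2 * y + x) → geomSubst (walkPoly n (x, y)) = 0 := by
  induction n with
  | zero =>
    refine ⟨fun r x y h => ?_, fun x y h => ?_⟩
    · obtain ⟨rfl, rfl, rfl⟩ : r = 0 ∧ x = 0 ∧ y = 0 := by omega
      rw [walkPoly_zero, if_pos rfl, geomSubst, Polynomial.aeval_X]
      ext m
      simp only [tableauSeries, tableauCount, coeff_mk, Nat.factorial_succ, Pi.one_apply]
      push_cast
      field_simp
      ring_nf
    · rw [walkPoly_zero, if_neg, map_zero]
      rintro ⟨rfl, rfl⟩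
      exact h 0 rfl
  | succ n ih =>
    obtain ⟨ih, ih'⟩ := ih
    refine ⟨fun r x y h => ?_, fun x y h => ?_⟩
    · have hN : geomSubst (walkPoly n (x, y + 1)) =
          if r = 0 then 0 else tableauSeries (r - 1) (r + y) (r + y + x) := by
        split_ifs with hr
        · exact ih' _ _ fun r' => by omega
        · rw [ih (r - 1) x (y + 1) (by omega), show r - 1 + (y + 1) = r + y by omega]
      have hSE : geomSubst (if y = 0 then 0 else walkPoly n (x + 1, y - 1)) =
          if r + y = r then 0 else tableauSeries r (r + y - 1) (r + y + x) := by
        split_ifs <;> try omega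
        · rw [map_zero]
        · rw [ih r (x + 1) (y - 1) (by omega), show r + (y - 1) + (x + 1) = r + y + x by omega,
            show r + (y - 1) = r + y - 1 by omega]
      rw [walkPoly_succ, sum_successors (walkPoly n), map_mul, map_add, map_add, hN, hSE]
      rcases x with _ | x
      · rw [if_pos rfl, if_pos rfl, map_zero, add_zero, Nat.add_zero,
          ← one_sub_X_mul_tableauSeries (by omega) (by omega), ← mul_assoc,
          geomSubst_X_mul_one_sub, one_mul]
      · rw [if_neg x.succ_ne_zero, if_neg x.succ_ne_zero, map_one, one_mul,
          tableauSeries_branching (a := r) (s := r + y) (by omega) (by omega),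
          ih r (x + 1 - 1) y (by omega)]
        rfl
    · rw [walkPoly_succ, sum_successors (walkPoly n), map_mul, map_add, map_add,
        ih' x (y + 1) fun r hr => h (r + 1) (by omega)]
      have hW : geomSubst (if x = 0 then 0 else walkPoly n (x - 1, y)) = 0 := by
        split_ifs
        · exact map_zero _
        · exact ih' _ _ fun r hr => h r (by omega)
      have hSE : geomSubst (if y = 0 then 0 else walkPoly n (x + 1, y - 1)) = 0 := by
        split_ifs
        · exact map_zero _
        · exact ih' _ _ fun r hr => h r (by omega)
      rw [hW, hSE, add_zero, add_zero, mul_zero]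

section DFinite

set_option linter.deprecated false

variable {R : Type*} [CommRing R]

lemma exists_eq_sum_C_mul_descPochhammer [IsDomain R] (p : Polynomial R) (m : ℕ)
    (hp : p.degree < m) :
    ∃ c : ℕ → R, p = ∑ j ∈ Finset.range m, Polynomial.C (c j) * descPochhammer R j := by
  induction m generalizing p with
  | zero =>
    refine ⟨0, ?_⟩
    rw [Finset.range_zero, Finset.sum_empty]
    exact Polynomial.degree_eq_bot.1 (by simpa using hp)
  | succ m ih =>
    obtain ⟨c, hc⟩ := ih (p - Polynomial.C (p.coeff m) * descPochhammer R m) <| by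
      rw [Polynomial.degree_lt_iff_coeff_zero] at hp ⊢
      intro k hk
      rw [Polynomial.coeff_sub, Polynomial.coeff_C_mul]
      have hdeg := descPochhammer_natDegree R m
      rcases hk.eq_or_lt with rfl | hk
      · have h := (monic_descPochhammer R m).coeff_natDegree
        rw [hdeg] at h
        rw [h, mul_one, sub_self]
      · rw [hp k hk, Polynomial.coeff_eq_zero_of_natDegree_lt (p := descPochhammer R m) (by omega),
          mul_zero, sub_zero]
    refine ⟨Function.update c m (p.coeff m), ?_⟩
    rw [Finset.sum_range_succ, Function.update_self, ← sub_eq_iff_eq_add, hc]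
    refine Finset.sum_congr rfl fun j hj => ?_
    rw [Function.update_of_ne (Finset.mem_range.1 hj).ne]

lemma coeff_iterate_derivativeFun (F : PowerSeries R) (j n : ℕ) :
    coeff n (PowerSeries.derivativeFun^[j] F) =
      ((n + j).descFactorial j : R) * coeff (n + j) F := by
  induction j generalizing n with
  | zero => simp
  | succ j ih =>
    rw [Function.iterate_succ_apply']
    change coeff n (PowerSeries.derivative R _) = _
    rw [coeff_derivative, ih, show n + 1 + j = n + (j + 1) by ring,
      Nat.descFactorial_succ, show n + (j + 1) - j = n + 1 by omega]
    push_cast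
    ring

lemma coeff_X_pow_mul_iterate_derivativeFun (F : PowerSeries R) (i j N : ℕ) :
    coeff N ((PowerSeries.X : PowerSeries R) ^ (i + j) * PowerSeries.derivativeFun^[j] F) =
      if i ≤ N then ((N - i).descFactorial j : R) * coeff (N - i) F else 0 := by
  rw [coeff_X_pow_mul', coeff_iterate_derivativeFun]
  split_ifs with h1 h2 h2
  · rw [show N - (i + j) + j = N - i by omega]
  · omega
  · rw [Nat.descFactorial_of_lt (by omega), Nat.cast_zero, zero_mul]
  · rfl

/-- A power series whose coefficients satisfy a linear recurrence with polynomial coefficients is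
D-finite. -/
lemma isDFinite_of_recurrence [IsDomain R] (F : PowerSeries R) (d : ℕ) (P : ℕ → Polynomial R)
    (hP : ∃ i < d, P i ≠ 0)
    (h : ∀ N, ∑ i ∈ Finset.range d,
      (if i ≤ N then (P i).eval ((N - i : ℕ) : R) * coeff (N - i) F else 0) = 0) :
    IsDFinite F := by
  set m := (Finset.range d).sup fun i => (P i).natDegree with hm
  have hdeg (i : ℕ) (hi : i < d) :
      ∃ c : ℕ → R, P i = ∑ j ∈ Finset.range (m + 1), Polynomial.C (c j) * descPochhammer R j := by
    refine exists_eq_sum_C_mul_descPochhammer _ _ (Polynomial.degree_le_natDegree.trans_lt ?_)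
    have := Finset.le_sup (f := fun i => (P i).natDegree) (Finset.mem_range.2 hi)
    exact_mod_cast Nat.lt_succ_of_le this
  choose! c hc using hdeg
  refine ⟨m, fun j => ∑ i ∈ Finset.range d,
    Polynomial.C (c i j) * Polynomial.X ^ (i + (j : ℕ)), ?_, ?_⟩
  · obtain ⟨i, hi, hPi⟩ := hP
    by_contra! h0
    refine hPi ?_
    rw [hc i hi]
    refine Finset.sum_eq_zero fun j hj => ?_
    have := congrArg (Polynomial.coeff · (i + j)) (h0 ⟨j, Finset.mem_range.1 hj⟩)
    simp only [Polynomial.finsetSum_coeff, Polynomial.coeff_C_mul, Polynomial.coeff_X_pow,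
      add_left_inj, mul_ite, mul_one, mul_zero, Finset.sum_ite_eq, Finset.mem_range, hi, if_true,
      Polynomial.coeff_zero] at this
    rw [this, map_zero, zero_mul]
  · ext N
    rw [map_zero, ← h N,
      Fin.sum_univ_eq_sum_range (fun j => ((∑ i ∈ Finset.range d, Polynomial.C (c i j) *
        Polynomial.X ^ (i + j) : Polynomial R) : PowerSeries R) *
          PowerSeries.derivativeFun^[j] F) (m + 1)]
    simp only [← Polynomial.coeToPowerSeries.ringHom_apply, map_sum, Finset.sum_mul]
    rw [Finset.sum_comm]
    refine Finset.sum_congr rfl fun i hi => ?_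
    simp only [Polynomial.coeToPowerSeries.ringHom_apply, Polynomial.coe_mul, Polynomial.coe_C,
      Polynomial.coe_pow, Polynomial.coe_X, mul_assoc, coeff_C_mul,
      coeff_X_pow_mul_iterate_derivativeFun]
    split_ifs
    · conv_rhs => rw [hc i (Finset.mem_range.1 hi)]
      rw [Polynomial.eval_finsetSum, Finset.sum_mul]
      refine Finset.sum_congr rfl fun j _ => ?_
      rw [Polynomial.eval_mul, Polynomial.eval_C, descPochhammer_eval_eq_descFactorial, mul_assoc]
    · simp

end DFinite

section Recurrence

variable {R : Type*} [CommRing R]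

/-- The coefficient of the `n`-th term in the recurrence for the loop enumerators, homogenized by
`w = b - 1`. -/
def loopRec₀ (n b w : R) : R :=
  6 * (2 * n - 1) * (3 * n + 1) * (3 * n + 2) * b ^ 3 *
    (2 * (2 * n + 1) * b ^ 2 - 3 * (5 * n + 4) * b * w + 3 * (3 * n + 2) * w ^ 2)

/-- The coefficient of the `n + 1`-st term in the recurrence for the loop enumerators, homogenized
by `w = b - 1`. -/
def loopRec₁ (n b w : R) : R :=
  (n + 2) * (-4 * (n + 3) * (4 * n ^ 2 - 1) * b ^ 5 - 12 * (n - 3) * (4 * n ^ 2 - 1) * b ^ 4 * w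
    + 3 * (195 * n ^ 3 + 106 * n ^ 2 + 41 * n + 18) * b ^ 3 * w ^ 2
    - 3 * (387 * n ^ 3 + 288 * n ^ 2 + 23 * n - 10) * b ^ 2 * w ^ 3
    + 9 * (99 * n ^ 3 + 72 * n ^ 2 - 5 * n - 6) * b * w ^ 4
    - 9 * (9 * n ^ 2 - 1) * (3 * n + 2) * w ^ 5)

/-- The coefficient of the `n + 2`-nd term in the recurrence for the loop enumerators, homogenized
by `w = b - 1`. -/
def loopRec₂ (n b w : R) : R :=
  (n + 2) ^ 2 * (n + 3) * w * (b - w) ^ 2 *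
    (2 * (2 * n - 1) * b ^ 2 - 3 * (5 * n - 1) * b * w + 3 * (3 * n - 1) * w ^ 2)

lemma map_loopRec₀ {S : Type*} [CommRing S] (f : R →+* S) (n b w : R) :
    f (loopRec₀ n b w) = loopRec₀ (f n) (f b) (f w) := by
  simp [loopRec₀, map_ofNat]

lemma map_loopRec₁ {S : Type*} [CommRing S] (f : R →+* S) (n b w : R) :
    f (loopRec₁ n b w) = loopRec₁ (f n) (f b) (f w) := by
  simp [loopRec₁, map_ofNat]

lemma map_loopRec₂ {S : Type*} [CommRing S] (f : R →+* S) (n b w : R) :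
    f (loopRec₂ n b w) = loopRec₂ (f n) (f b) (f w) := by
  simp [loopRec₂, map_ofNat]

end Recurrence

lemma tableauCount_rectangle (n m : ℕ) :
    tableauCount n n (n + m) =
      (3 * n + m).factorial * ((m + 1) * (m + 2)) /
        (n.factorial * (n + 1).factorial * (n + m + 2).factorial) := by
  rw [tableauCount, show n + n + (n + m) = 3 * n + m by ring]
  push_cast
  ring

section Coefficients

variable (n m : ℕ) (F : PowerSeries ℚ)

lemma coeff_X_pow_mul_ite (j : ℕ) :
    coeff m ((PowerSeries.X : PowerSeries ℚ) ^ j * F) =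
      if j ≤ m then coeff (m - j) F else 0 :=
  coeff_X_pow_mul' F j m

lemma coeff_loopRec₀_mul :
    coeff m (loopRec₀ (n : PowerSeries ℚ) 1 PowerSeries.X * F) =
      6 * (2 * n - 1) * (3 * n + 1) * (3 * n + 2) * (2 * (2 * n + 1) * coeff m F
        - 3 * (5 * n + 4) * (if 1 ≤ m then coeff (m - 1) F else 0)
        + 3 * (3 * n + 2) * if 2 ≤ m then coeff (m - 2) F else 0) := by
  have h : loopRec₀ (n : PowerSeries ℚ) 1 PowerSeries.X * F =
      PowerSeries.C (6 * (2 * n - 1) * (3 * n + 1) * (3 * n + 2) : ℚ) *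
        (PowerSeries.C (2 * (2 * n + 1) : ℚ) * F
          - PowerSeries.C (3 * (5 * n + 4) : ℚ) * (PowerSeries.X ^ 1 * F)
          + PowerSeries.C (3 * (3 * n + 2) : ℚ) * (PowerSeries.X ^ 2 * F)) := by
    simp only [loopRec₀, map_add, map_sub, map_mul, map_ofNat, map_natCast, map_one]
    ring
  simp only [h, LinearMap.map_add, LinearMap.map_sub, coeff_C_mul, coeff_X_pow_mul_ite]

lemma coeff_loopRec₁_mul :
    coeff m (loopRec₁ (n : PowerSeries ℚ) 1 PowerSeries.X * F) =
      (n + 2) * (-4 * (n + 3) * (4 * n ^ 2 - 1) * coeff m F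
        - 12 * (n - 3) * (4 * n ^ 2 - 1) * (if 1 ≤ m then coeff (m - 1) F else 0)
        + 3 * (195 * n ^ 3 + 106 * n ^ 2 + 41 * n + 18) *
          (if 2 ≤ m then coeff (m - 2) F else 0)
        - 3 * (387 * n ^ 3 + 288 * n ^ 2 + 23 * n - 10) *
          (if 3 ≤ m then coeff (m - 3) F else 0)
        + 9 * (99 * n ^ 3 + 72 * n ^ 2 - 5 * n - 6) * (if 4 ≤ m then coeff (m - 4) F else 0)
        - 9 * (9 * n ^ 2 - 1) * (3 * n + 2) * if 5 ≤ m then coeff (m - 5) F else 0) := by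
  have h : loopRec₁ (n : PowerSeries ℚ) 1 PowerSeries.X * F =
      PowerSeries.C (n + 2 : ℚ) *
        (PowerSeries.C (-4 * (n + 3) * (4 * n ^ 2 - 1) : ℚ) * F
          - PowerSeries.C (12 * (n - 3) * (4 * n ^ 2 - 1) : ℚ) * (PowerSeries.X ^ 1 * F)
          + PowerSeries.C (3 * (195 * n ^ 3 + 106 * n ^ 2 + 41 * n + 18) : ℚ) *
            (PowerSeries.X ^ 2 * F)
          - PowerSeries.C (3 * (387 * n ^ 3 + 288 * n ^ 2 + 23 * n - 10) : ℚ) *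
            (PowerSeries.X ^ 3 * F)
          + PowerSeries.C (9 * (99 * n ^ 3 + 72 * n ^ 2 - 5 * n - 6) : ℚ) *
            (PowerSeries.X ^ 4 * F)
          - PowerSeries.C (9 * (9 * n ^ 2 - 1) * (3 * n + 2) : ℚ) *
            (PowerSeries.X ^ 5 * F)) := by
    simp only [loopRec₁, map_add, map_sub, map_mul, map_neg, map_pow, map_ofNat, map_natCast,
      map_one]
    ring
  simp only [h, LinearMap.map_add, LinearMap.map_sub, coeff_C_mul, coeff_X_pow_mul_ite]

lemma coeff_loopRec₂_mul :
    coeff m (loopRec₂ (n : PowerSeries ℚ) 1 PowerSeries.X * F) =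
      (n + 2) ^ 2 * (n + 3) * (2 * (2 * n - 1) * (if 1 ≤ m then coeff (m - 1) F else 0)
        + (7 - 23 * n) * (if 2 ≤ m then coeff (m - 2) F else 0)
        + (43 * n - 11) * (if 3 ≤ m then coeff (m - 3) F else 0)
        + (9 - 33 * n) * (if 4 ≤ m then coeff (m - 4) F else 0)
        + 3 * (3 * n - 1) * if 5 ≤ m then coeff (m - 5) F else 0) := by
  have h : loopRec₂ (n : PowerSeries ℚ) 1 PowerSeries.X * F =
      PowerSeries.C ((n + 2) ^ 2 * (n + 3) : ℚ) *
        (PowerSeries.C (2 * (2 * n - 1) : ℚ) * (PowerSeries.X ^ 1 * F)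
          + PowerSeries.C (7 - 23 * n : ℚ) * (PowerSeries.X ^ 2 * F)
          + PowerSeries.C (43 * n - 11 : ℚ) * (PowerSeries.X ^ 3 * F)
          + PowerSeries.C (9 - 33 * n : ℚ) * (PowerSeries.X ^ 4 * F)
          + PowerSeries.C (3 * (3 * n - 1) : ℚ) * (PowerSeries.X ^ 5 * F)) := by
    simp only [loopRec₂, map_add, map_sub, map_mul, map_pow, map_ofNat, map_natCast, map_one]
    ring
  simp only [h, LinearMap.map_add, coeff_C_mul, coeff_X_pow_mul_ite]

end Coefficients

lemma coeff_tableauSeries_rectangle (n m : ℕ) :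
    coeff m (tableauSeries n n n) =
      (3 * n + m).factorial * ((m + 1) * (m + 2)) /
        (n.factorial * (n + 1).factorial * (n + m + 2).factorial) := by
  rw [tableauSeries, coeff_mk, tableauCount_rectangle]

lemma coeff_tableauSeries_rectangle_add (n k i j : ℕ) :
    coeff (k + j) (tableauSeries (n + i) (n + i) (n + i)) =
      (3 * n + k + (3 * i + j)).factorial * ((k + j + 1) * (k + j + 2)) *
        ((n + i).factorial : ℚ)⁻¹ * ((n + (i + 1)).factorial : ℚ)⁻¹ *
          ((n + k + (i + j + 2)).factorial : ℚ)⁻¹ := by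
  rw [coeff_tableauSeries_rectangle, show 3 * (n + i) + (k + j) = 3 * n + k + (3 * i + j) by ring,
    show n + i + (k + j) + 2 = n + k + (i + j + 2) by ring, add_assoc n i 1]
  push_cast
  field_simp

lemma inv_factorial_eq (a : ℕ) : (a.factorial : ℚ)⁻¹ = (a + 1) * ((a + 1).factorial : ℚ)⁻¹ := by
  rw [Nat.factorial_succ]
  push_cast
  field_simp

lemma coeff_tableauSeries_recurrence_of_five_le (n k : ℕ) :
    coeff (k + 5) (loopRec₀ (n : PowerSeries ℚ) 1 PowerSeries.X * tableauSeries n n n +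
      loopRec₁ (n : PowerSeries ℚ) 1 PowerSeries.X * tableauSeries (n + 1) (n + 1) (n + 1) +
      loopRec₂ (n : PowerSeries ℚ) 1 PowerSeries.X *
        tableauSeries (n + 2) (n + 2) (n + 2)) = 0 := by
  rw [map_add, map_add, coeff_loopRec₀_mul, coeff_loopRec₁_mul, coeff_loopRec₂_mul]
  have hT (j : ℕ) : ((3 * n + k + (j + 1)).factorial : ℚ) =
      (3 * n + k + j + 1) * (3 * n + k + j).factorial := by
    rw [← add_assoc, Nat.factorial_succ]
    push_cast
    ring
  have hD (j : ℕ) : ((n + k + j).factorial : ℚ)⁻¹ =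
      (n + k + j + 1) * ((n + k + (j + 1)).factorial : ℚ)⁻¹ := by
    rw [inv_factorial_eq]
    push_cast
    ring_nf
  have hE (j : ℕ) : ((n + j).factorial : ℚ)⁻¹ =
      (n + j + 1) * ((n + (j + 1)).factorial : ℚ)⁻¹ := by
    rw [inv_factorial_eq]
    push_cast
    ring_nf
  have key (i j : ℕ) := coeff_tableauSeries_rectangle_add n k i j
  have h0 (j : ℕ) := key 0 j
  simp only [Nat.add_zero, Nat.mul_zero, Nat.zero_add] at h0
  have hk (i : ℕ) := key i 0
  simp only [Nat.add_zero] at hk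
  simp only [show 1 ≤ k + 5 by omega, show 2 ≤ k + 5 by omega, show 3 ≤ k + 5 by omega,
    show 4 ≤ k + 5 by omega, show 5 ≤ k + 5 by omega, if_true, Nat.reduceSubDiff,
    Nat.add_sub_cancel, h0, hk, key, Nat.reduceAdd, Nat.reduceMul]
  rw [hT 9, hT 8, hT 7, hT 6, hT 5, hT 4, hT 3, hD 3, hD 4, hD 5, hD 6, hD 7,
    show ((n.factorial : ℚ))⁻¹ = _ from hE 0, hE 1, hE 2]
  push_cast
  ring

lemma tableauSeries_recurrence (n : ℕ) :
    loopRec₀ (n : PowerSeries ℚ) 1 PowerSeries.X * tableauSeries n n n +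
      loopRec₁ (n : PowerSeries ℚ) 1 PowerSeries.X * tableauSeries (n + 1) (n + 1) (n + 1) +
      loopRec₂ (n : PowerSeries ℚ) 1 PowerSeries.X * tableauSeries (n + 2) (n + 2) (n + 2) = 0 := by
  ext m
  obtain ⟨k, rfl⟩ | h : (∃ k, m = k + 5) ∨ m < 5 := by
    rcases le_or_gt 5 m with h | h
    · exact .inl ⟨m - 5, by omega⟩
    · exact .inr h
  · rw [coeff_tableauSeries_recurrence_of_five_le, map_zero]
  · rw [map_add, map_add, coeff_loopRec₀_mul, coeff_loopRec₁_mul, coeff_loopRec₂_mul, map_zero]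
    simp only [coeff_tableauSeries_rectangle]
    interval_cases m
    all_goals
      norm_num [Nat.mul_add, Nat.factorial_succ, -mul_eq_zero]
      field_simp
      ring

/-- The loop enumerators of the model with the steps north, west and south-east. -/
noncomputable abbrev tandemLoopGF : PowerSeries (Polynomial ℚ) :=
  loopGF ({((0 : ℤ), (1 : ℤ)), (-1, 0), (1, -1)} : Set (ℤ × ℤ)) (1 : Polynomial ℚ) Polynomial.X

lemma coeff_tandemLoopGF_of_not_dvd {n : ℕ} (h : ¬ 3 ∣ n) : coeff n tandemLoopGF = 0 := by
  refine (mul_eq_zero.1 (?_ : Polynomial.X * coeff n tandemLoopGF = 0)).resolve_left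
    Polynomial.X_ne_zero
  refine geomSubst_injective ?_
  rw [X_mul_coeff_loopGF, (geomSubst_walkPoly n).2 0 0 fun r hr => h ⟨r, by omega⟩, map_zero]

lemma geomSubst_X_mul_coeff_tandemLoopGF (n : ℕ) :
    geomSubst (Polynomial.X * coeff (3 * n) tandemLoopGF) = tableauSeries n n n := by
  rw [X_mul_coeff_loopGF, (geomSubst_walkPoly (3 * n)).1 n 0 0 rfl]
  rfl

section Homogeneity

variable {R : Type*} [CommRing R] (n b w : R)

lemma loopRec₀_mul : loopRec₀ n b (b * w) = b ^ 5 * loopRec₀ n 1 w := by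
  simp only [loopRec₀]
  ring

lemma loopRec₁_mul : loopRec₁ n b (b * w) = b ^ 5 * loopRec₁ n 1 w := by
  simp only [loopRec₁]
  ring

lemma loopRec₂_mul : loopRec₂ n b (b * w) = b ^ 5 * loopRec₂ n 1 w := by
  simp only [loopRec₂]
  ring

end Homogeneity

lemma tandemLoopGF_recurrence (n : ℕ) :
    loopRec₀ (n : Polynomial ℚ) Polynomial.X (Polynomial.X - 1) * coeff (3 * n) tandemLoopGF +
      loopRec₁ (n : Polynomial ℚ) Polynomial.X (Polynomial.X - 1) *
        coeff (3 * (n + 1)) tandemLoopGF +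
      loopRec₂ (n : Polynomial ℚ) Polynomial.X (Polynomial.X - 1) *
        coeff (3 * (n + 2)) tandemLoopGF = 0 := by
  refine (mul_eq_zero.1 (geomSubst_injective ?_ : Polynomial.X * _ = 0)).resolve_left
    Polynomial.X_ne_zero
  have hw : geomSubst (Polynomial.X - 1) = geomSubst Polynomial.X * PowerSeries.X := by
    rw [map_sub, map_one, ← geomSubst_X_mul_one_sub]
    ring
  have h (i : ℕ) := geomSubst_X_mul_coeff_tandemLoopGF (n + i)
  rw [mul_add, mul_add, mul_left_comm, mul_left_comm _ (loopRec₁ _ _ _),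
    mul_left_comm _ (loopRec₂ _ _ _), map_add, map_add, map_mul, map_mul _ (loopRec₁ _ _ _),
    map_mul _ (loopRec₂ _ _ _), ← AlgHom.coe_toRingHom, map_loopRec₀, map_loopRec₁, map_loopRec₂,
    AlgHom.coe_toRingHom, hw, map_natCast, h 1, h 2, loopRec₀_mul, loopRec₁_mul, loopRec₂_mul,
    geomSubst_X_mul_coeff_tandemLoopGF, mul_assoc, mul_assoc, mul_assoc, ← mul_add, ← mul_add,
    tableauSeries_recurrence, mul_zero, map_zero]

/-- The argument `X / 3 - j` of the recurrence, as a polynomial in the length of the loop. -/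
noncomputable def shiftedThird (j : Polynomial ℚ) : Polynomial (Polynomial ℚ) :=
  Polynomial.C (Polynomial.C (1 / 3)) * Polynomial.X - Polynomial.C j

lemma eval_shiftedThird (k : ℕ) (j : Polynomial ℚ) :
    (shiftedThird j).eval ((3 * k : ℕ) : Polynomial ℚ) = k - j := by
  have h : Polynomial.C (1 / 3 : ℚ) * (3 : Polynomial ℚ) = 1 := by
    rw [← map_ofNat Polynomial.C 3, ← map_mul]
    norm_num
  simp only [shiftedThird, Polynomial.eval_sub, Polynomial.eval_mul, Polynomial.eval_C,
    Polynomial.eval_X]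
  push_cast
  rw [← mul_assoc, h, one_mul]

/-- The coefficients of the recurrence in the length of the loop. -/
noncomputable def lengthRec (i : ℕ) : Polynomial (Polynomial ℚ) :=
  let b := Polynomial.C Polynomial.X
  let w := Polynomial.C (Polynomial.X - 1)
  if i = 0 then (shiftedThird 2 + 1) * loopRec₂ (shiftedThird 2) b w
  else if i = 3 then (shiftedThird 1 + 1) * loopRec₁ (shiftedThird 1) b w
  else if i = 6 then (shiftedThird 0 + 1) * loopRec₀ (shiftedThird 0) b w
  else 0

lemma eval_lengthRec_zero (k : ℕ) :
    (lengthRec 0).eval ((3 * k : ℕ) : Polynomial ℚ) =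
      (k - 2 + 1) * loopRec₂ (k - 2 : Polynomial ℚ) Polynomial.X (Polynomial.X - 1) := by
  rw [lengthRec, if_pos rfl, ← Polynomial.coe_evalRingHom, map_mul, map_loopRec₂]
  simp only [map_add, map_one, Polynomial.coe_evalRingHom, eval_shiftedThird, Polynomial.eval_C]

lemma eval_lengthRec_three (k : ℕ) :
    (lengthRec 3).eval ((3 * k : ℕ) : Polynomial ℚ) =
      (k - 1 + 1) * loopRec₁ (k - 1 : Polynomial ℚ) Polynomial.X (Polynomial.X - 1) := by
  rw [lengthRec, if_neg (by decide), if_pos rfl, ← Polynomial.coe_evalRingHom, map_mul,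
    map_loopRec₁]
  simp only [map_add, map_one, Polynomial.coe_evalRingHom, eval_shiftedThird, Polynomial.eval_C]

lemma eval_lengthRec_six (k : ℕ) :
    (lengthRec 6).eval ((3 * k : ℕ) : Polynomial ℚ) =
      (k + 1) * loopRec₀ (k : Polynomial ℚ) Polynomial.X (Polynomial.X - 1) := by
  rw [lengthRec, if_neg (by decide), if_neg (by decide), if_pos rfl, ← Polynomial.coe_evalRingHom,
    map_mul, map_loopRec₀]
  simp only [map_add, map_one, Polynomial.coe_evalRingHom, eval_shiftedThird, Polynomial.eval_C,
    sub_zero]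

lemma lengthRec_six_ne_zero : lengthRec 6 ≠ 0 := by
  intro h
  have h0 := eval_lengthRec_six 0
  rw [h, Polynomial.eval_zero] at h0
  have h1 := congrArg (Polynomial.evalRingHom (1 : ℚ)) h0
  rw [map_mul, map_loopRec₀] at h1
  norm_num [loopRec₀] at h1

lemma sum_lengthRec (N : ℕ) :
    ∑ i ∈ Finset.range 7, (if i ≤ N then (lengthRec i).eval ((N - i : ℕ) : Polynomial ℚ) *
      coeff (N - i) tandemLoopGF else 0) = 0 := by
  have h (i : ℕ) (hi : ¬ 3 ∣ i) : lengthRec i = 0 := by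
    rw [lengthRec, if_neg (by omega), if_neg (by omega), if_neg (by omega)]
  by_cases hN : 3 ∣ N
  · obtain ⟨k, rfl⟩ := hN
    simp only [Finset.sum_range_succ, Finset.sum_range_zero, h 1 (by omega), h 2 (by omega),
      h 4 (by omega), h 5 (by omega), Polynomial.eval_zero, zero_mul, ite_self, zero_add, add_zero]
    obtain rfl | rfl | ⟨n, rfl⟩ : k = 0 ∨ k = 1 ∨ ∃ n, k = n + 2 := by
      rcases k with _ | _ | n
      · exact .inl rfl
      · exact .inr (.inl rfl)
      · exact .inr (.inr ⟨n, rfl⟩)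
    · have h0 := eval_lengthRec_zero 0
      norm_num [loopRec₂] at h0
      simp [h0]
    · have h0 := eval_lengthRec_zero 1
      have h3 := eval_lengthRec_three 0
      norm_num at h0 h3
      simp [h0, h3]
    · rw [if_pos (by omega), if_pos (by omega), if_pos (by omega), Nat.sub_zero,
        show 3 * (n + 2) - 3 = 3 * (n + 1) by omega, show 3 * (n + 2) - 6 = 3 * n by omega,
        eval_lengthRec_zero, eval_lengthRec_three, eval_lengthRec_six]
      have h1 : ((n + 1 : ℕ) : Polynomial ℚ) - 1 = n := by push_cast; ring
      have h2 : ((n + 2 : ℕ) : Polynomial ℚ) - 2 = n := by push_cast; ring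
      rw [h1, h2]
      linear_combination ((n : Polynomial ℚ) + 1) * tandemLoopGF_recurrence n
  · refine Finset.sum_eq_zero fun i _ => ?_
    split_ifs with hi
    · by_cases h3 : 3 ∣ i
      · rw [coeff_tandemLoopGF_of_not_dvd fun hd => hN ((Nat.dvd_sub_iff_left hi h3).1 hd), mul_zero]
      · rw [h i h3, Polynomial.eval_zero, zero_mul]
    · rfl

/-- Model 17: `G(t;1,b)` is D-finite. -/
theorem model17_G1b_dfinite :
    IsDFinite (loopGF ({((0:ℤ), (1:ℤ)), (-1, 0), (1, -1)} : Set (ℤ × ℤ)) (1 : Polynomial ℚ) Polynomial.X) := by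
  exact isDFinite_of_recurrence _ 7 lengthRec ⟨6, by norm_num, lengthRec_six_ne_zero⟩ sum_lengthRec
end
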